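/- Assume A, C, D and that all functions c_i^ℓ (i ∈ N, ℓ ∈ L_0) are bounded. Then the correspondence S : ∏_{i=1}^n M_i → ∏_{i=1}^n M_i defined by S(μ_1,...,μ_n) = ∏_{i=1}^n O_i(φ_{-i}), where for each j ∈ N, φ_j ∈ Φ_j is the unique stationary strategy with μ_j = μ̂_j φ_j, is well defined, has nonempty compact convex values, and is upper semicontinuous when ∏_{i=1}^n M_i carries the product of the weak topologies. -/

import Mathlib

open MeasureTheory ProbabilityTheory Filter Topology
open scoped ENNReal NNReal

namespace CSGame

/-- The joint action space of the players. -/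
abbrev JA {n : ℕ} (A : Fin n → Type) : Type := (i : Fin n) → A i

/-- The data of a constrained discounted stochastic Markov game:
countable state space `X`, Borel action spaces `A i` with compact admissible
action sets `As i x`, transition probability `p`, initial distribution `η`,
discount factor `α`, cost/constraint functions `c i ℓ` (`ℓ = 0` is the cost,
`ℓ ∈ L = {1,…,l}` are the constraints) and constraint bounds `κ i ℓ`. -/
structure GameData (n l : ℕ) (X : Type) (A : Fin n → Type)
    [MeasurableSpace X] [∀ i, MeasurableSpace (A i)] [∀ i, TopologicalSpace (A i)] where
  As : (i : Fin n) → X → Set (A i)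
  p : X → JA A → Measure X
  η : Measure X
  α : ℝ
  c : Fin n → Fin (l + 1) → X → JA A → ℝ
  κ : Fin n → Fin (l + 1) → ℝ
  hAs_ne : ∀ i x, (As i x).Nonempty
  hAs_cpt : ∀ i x, IsCompact (As i x)
  hp : ∀ x a, IsProbabilityMeasure (p x a)
  hpm : ∀ x y, Measurable fun a => p x a {y}
  hη : IsProbabilityMeasure η
  hα0 : 0 < α
  hα1 : α < 1
  hc : ∀ i ℓ x, Measurable (c i ℓ x)

variable {n l : ℕ}
variable {X : Type} [Countable X] [MeasurableSpace X] [DiscreteMeasurableSpace X]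
  [TopologicalSpace X] [DiscreteTopology X] [BorelSpace X] [SecondCountableTopology X]
variable {A : Fin n → Type} [∀ i, MeasurableSpace (A i)] [∀ i, TopologicalSpace (A i)]
  [∀ i, PolishSpace (A i)] [∀ i, BorelSpace (A i)]

/-- The set of feasible action profiles in state `x` (the section of `𝕂` at `x`). -/
def jointSet (G : GameData n l X A) (x : X) : Set (JA A) :=
  Set.univ.pi fun i => G.As i x

/-- Histories of the game: `Hist X AA t` records the initial state and `t`
state-action transitions, ending with the current state (this is `H^{t+1}`). -/
def Hist (X AA : Type) : ℕ → Type
  | 0 => X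
  | t + 1 => Hist X AA t × AA × X

noncomputable instance histMS (X AA : Type) [MeasurableSpace X] [MeasurableSpace AA] :
    ∀ t, MeasurableSpace (Hist X AA t)
  | 0 => inferInstanceAs (MeasurableSpace X)
  | t + 1 =>
      letI := histMS X AA t
      inferInstanceAs (MeasurableSpace (Hist X AA t × AA × X))

/-- The current (last) state of a history. -/
def lastState (X AA : Type) : ∀ t, Hist X AA t → X
  | 0, h => h
  | _ + 1, h => h.2.2

theorem measurable_lastState (X AA : Type) [MeasurableSpace X] [MeasurableSpace AA] :
    ∀ t, Measurable (lastState X AA t)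
  | 0 => measurable_id
  | _ + 1 => measurable_snd.comp measurable_snd

variable (G : GameData n l X A)

/-- A (history dependent, randomised) strategy of player `i`: a sequence of
transition probabilities from histories to the action space of player `i`,
concentrated on the admissible action set at the current state. -/
structure Strategy (i : Fin n) where
  f : ∀ t, Hist X (JA A) t → ProbabilityMeasure (A i)
  meas : ∀ t (s : Set (A i)), MeasurableSet s →
    Measurable fun h => (f t h : Measure (A i)) s
  supp : ∀ t h, f t h (G.As i (lastState X (JA A) t h)) = 1

/-- A stationary strategy of player `i`: a transition probability from states to
actions, concentrated on the admissible action set. -/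
def Stat (i : Fin n) : Type :=
  {φ : X → ProbabilityMeasure (A i) // ∀ x, φ x (G.As i x) = 1}

noncomputable instance (i : Fin n) : TopologicalSpace (Stat G i) :=
  inferInstanceAs (TopologicalSpace
    {φ : X → ProbabilityMeasure (A i) // ∀ x, φ x (G.As i x) = 1})

/-- Multi-strategies: one strategy for each player. -/
abbrev MultiStrategy : Type _ := ∀ i, Strategy G i

/-- Stationary multi-strategies (the set `Φ`). -/
abbrev StatProfile : Type _ := ∀ i, Stat G i

noncomputable instance : TopologicalSpace (StatProfile G) :=
  inferInstanceAs (TopologicalSpace (∀ i, Stat G i))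

/-- The strategy induced by a stationary strategy. -/
noncomputable def ofStat (i : Fin n) (φ : Stat G i) : Strategy G i where
  f := fun t h => φ.1 (lastState X (JA A) t h)
  meas := fun t _s _hs =>
    (Measurable.of_discrete (f := fun x => (φ.1 x : Measure (A i)) _s)).comp
      (measurable_lastState X (JA A) t)
  supp := fun t h => φ.2 _

/-- The multi-strategy induced by a stationary multi-strategy. -/
noncomputable def ofStatAll (φ : StatProfile G) : MultiStrategy G :=
  fun i => ofStat G i (φ i)

/-- `[π_{-i}, σ]` : player `i` deviates to `σ`, the others keep `π`. -/
noncomputable def combine (π : MultiStrategy G) (i : Fin n) (σ : Strategy G i) :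
    MultiStrategy G :=
  Function.update π i σ

/-- `[φ_{-i}, γ]` for stationary profiles. -/
noncomputable def updStat (φ : StatProfile G) (i : Fin n) (γ : Stat G i) :
    StatProfile G :=
  Function.update φ i γ

/-- The joint (product) distribution of the players' actions after history `h`. -/
noncomputable def jointLaw (π : MultiStrategy G) (t : ℕ) (h : Hist X (JA A) t) :
    Measure (JA A) :=
  Measure.pi fun i => ((π i).f t h : Measure (A i))

/-- The distribution of histories of length `t` under the multi-strategy `π`,
the transition probability `G.p` and the initial distribution `η'`
(the finite-dimensional marginals of the Ionescu–Tulcea measure `P^π_{η'}`). -/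
noncomputable def histMeas (η' : Measure X) (π : MultiStrategy G) :
    ∀ t, Measure (Hist X (JA A) t)
  | 0 => η'
  | t + 1 =>
      (histMeas η' π t).bind fun h =>
        (jointLaw G π t h).bind fun a =>
          (G.p (lastState X (JA A) t h) a).map fun y =>
            (show Hist X (JA A) (t + 1) from (h, a, y))

/-- Expected value of `f (x^{t+1}, a^{t+1})` under `π` (states enumerated from `1`
in the paper, from `0` here). -/
noncomputable def stageExp (η' : Measure X) (π : MultiStrategy G) (t : ℕ)
    (f : X → JA A → ℝ) : ℝ :=
  ∫ h, (∫ a, f (lastState X (JA A) t h) a ∂(jointLaw G π t h)) ∂(histMeas G η' π t)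

/-- The expected discounted cost functional
`J(π) = (1-α) E^π_{η'} [∑_{t≥1} α^{t-1} f(x^t,a^t)]`. -/
noncomputable def Jfun (η' : Measure X) (f : X → JA A → ℝ) (π : MultiStrategy G) : ℝ :=
  (1 - G.α) * ∑' t : ℕ, G.α ^ t * stageExp G η' π t f

/-- `J_i^ℓ(π)` of the paper. -/
noncomputable def J (i : Fin n) (ℓ : Fin (l + 1)) (π : MultiStrategy G) : ℝ :=
  Jfun G G.η (G.c i ℓ) π

/-- `π_i ∈ Δ_i(π_{-i})` : all constraints of player `i` are satisfied. -/
def Feas (i : Fin n) (π : MultiStrategy G) : Prop :=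
  ∀ ℓ : Fin (l + 1), ℓ ≠ 0 → J G i ℓ π ≤ G.κ i ℓ

/-- Expectation of `w(x^{t+1})` (as an extended nonnegative real). -/
noncomputable def wStateExp (η' : Measure X) (π : MultiStrategy G) (t : ℕ)
    (w : X → ℝ) : ℝ≥0∞ :=
  ∫⁻ h, ENNReal.ofReal (w (lastState X (JA A) t h)) ∂(histMeas G η' π t)

/-- Assumption A(i): continuity of the transition probability in the actions. -/
def AssumptionA1 : Prop :=
  ∀ x y, ContinuousOn (fun a => G.p x a {y}) (jointSet G x)

/-- Assumption A: continuity of the transition probability and of the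
cost/constraint functions in the actions. -/
def AssumptionA : Prop :=
  AssumptionA1 G ∧ ∀ i ℓ x, ContinuousOn (G.c i ℓ x) (jointSet G x)

/-- Assumption B for the weight function `w`: `w ≥ 1` bounds all the costs on `𝕂`,
the discounted tails `sup_π (1-α) E^π_η[∑_{t≥k} α^{t-1} w(x^t)]` vanish as `k → ∞`,
and for each stage `t` the family `{w(x^t)}` is uniformly integrable over all
multi-strategies. -/
def AssumptionB (w : X → ℝ) : Prop :=
  (∀ x, 1 ≤ w x) ∧
  (∀ i ℓ x a, a ∈ jointSet G x → |G.c i ℓ x a| ≤ w x) ∧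
  Tendsto (fun k : ℕ => ⨆ π : MultiStrategy G,
      ENNReal.ofReal (1 - G.α) *
        ∑' t : ℕ, ENNReal.ofReal G.α ^ (k + t) * wStateExp G G.η π (k + t) w)
    atTop (𝓝 0) ∧
  ∀ t : ℕ, Tendsto (fun k : ℕ => ⨆ π : MultiStrategy G,
      ∫⁻ h in {h | (k : ℝ) ≤ w (lastState X (JA A) t h)},
        ENNReal.ofReal (w (lastState X (JA A) t h)) ∂(histMeas G G.η π t))
    atTop (𝓝 0)

/-- Assumption C (Slater condition). -/
def AssumptionC : Prop :=
  ∀ (φ : StatProfile G) (i : Fin n), ∃ π : Strategy G i,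
    ∀ ℓ : Fin (l + 1), ℓ ≠ 0 → J G i ℓ (combine G (ofStatAll G φ) i π) < G.κ i ℓ

/-- Assumption D: the initial distribution charges every state. -/
def AssumptionD : Prop :=
  ∀ x : X, 0 < G.η {x}

/-- Assumption W (weighted-norm conditions of Wessels). -/
def AssumptionW (w : X → ℝ) : Prop :=
  (∀ x, 1 ≤ w x) ∧
  (∀ i ℓ x a, a ∈ jointSet G x → |G.c i ℓ x a| ≤ w x) ∧
  (∃ δ : ℝ, 1 ≤ δ ∧ δ * G.α < 1 ∧ ∀ x a, a ∈ jointSet G x →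
      ∫⁻ y, ENNReal.ofReal (w y) ∂(G.p x a) ≤ ENNReal.ofReal (δ * w x)) ∧
  (∀ x, ContinuousOn (fun a => ∫⁻ y, ENNReal.ofReal (w y) ∂(G.p x a)) (jointSet G x)) ∧
  (∫⁻ y, ENNReal.ofReal (w y) ∂G.η) < ⊤

/-- All cost and constraint functions are bounded. -/
def BoundedCosts : Prop :=
  ∀ i (ℓ : Fin (l + 1)), ∃ C : ℝ, ∀ x a, |G.c i ℓ x a| ≤ C

/-- A stationary multi-strategy `φ` is a Nash equilibrium of the constrained game:
it is feasible, and no player can lower his discounted cost by a unilateral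
deviation to any (history dependent) strategy satisfying his constraints. -/
def IsNashStat (φ : StatProfile G) : Prop :=
  (∀ i, Feas G i (ofStatAll G φ)) ∧
  ∀ (i : Fin n) (σ : Strategy G i), Feas G i (combine G (ofStatAll G φ) i σ) →
    J G i 0 (ofStatAll G φ) ≤ J G i 0 (combine G (ofStatAll G φ) i σ)

section Occupation

/-- A correlated strategy of the players. -/
structure CorrStrategy where
  f : ∀ t, Hist X (JA A) t → ProbabilityMeasure (JA A)
  meas : ∀ t (s : Set (JA A)), MeasurableSet s →
    Measurable fun h => (f t h : Measure (JA A)) s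
  supp : ∀ t h, f t h (jointSet G (lastState X (JA A) t h)) = 1

/-- History distributions under a correlated strategy. -/
noncomputable def histMeasC (π : CorrStrategy G) : ∀ t, Measure (Hist X (JA A) t)
  | 0 => G.η
  | t + 1 =>
      (histMeasC π t).bind fun h =>
        ((π.f t h : Measure (JA A))).bind fun a =>
          (G.p (lastState X (JA A) t h) a).map fun y =>
            (show Hist X (JA A) (t + 1) from (h, a, y))

/-- The occupation measure `ρ(K') = (1-α) E^π_η [∑_{t≥1} α^{t-1} 1_{K'}(x^t,a^t)]`
of a correlated strategy, as a measure on the state–action pairs. -/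
noncomputable def occ (π : CorrStrategy G) : Measure (X × JA A) :=
  ENNReal.ofReal (1 - G.α) •
    Measure.sum fun t : ℕ => ENNReal.ofReal G.α ^ t •
      ((histMeasC G π t).bind fun h =>
        (π.f t h : Measure (JA A)).map fun a => (lastState X (JA A) t h, a))

/-- The set `𝓜` of occupation measures of correlated strategies. -/
def OccSet : Set (ProbabilityMeasure (X × JA A)) :=
  {ρ | ∃ π : CorrStrategy G, (ρ : Measure (X × JA A)) = occ G π}

/-- Projection of a state–action pair onto the coordinates of player `i`. -/
def projAct (i : Fin n) : X × JA A → X × A i := fun q => (q.1, q.2 i)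

/-- The set `𝓜_i` of statewise projections of occupation measures onto `𝕂_i`. -/
def MiSet (i : Fin n) : Set (ProbabilityMeasure (X × A i)) :=
  {μ | ∃ ρ ∈ OccSet G, (μ : Measure (X × A i)) = (ρ : Measure (X × JA A)).map (projAct i)}

/-- The marginal `μ̂(x) = μ({x} × A_i(x))`. -/
noncomputable def marg (i : Fin n) (μ : ProbabilityMeasure (X × A i)) (x : X) : ℝ≥0∞ :=
  (μ : Measure (X × A i)) ({x} ×ˢ G.As i x)

/-- `μ = μ̂ φ` : `φ` disintegrates `μ`, i.e. `μ({x} × B) = φ(B|x) μ̂(x)`. -/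
def Disint (i : Fin n) (μ : ProbabilityMeasure (X × A i)) (φ : Stat G i) : Prop :=
  ∀ x (B : Set (A i)), MeasurableSet B → B ⊆ G.As i x →
    (μ : Measure (X × A i)) ({x} ×ˢ B) = (φ.1 x B : ℝ≥0∞) * marg G i μ x

/-- The occupation measure on state–action pairs of a multi-strategy. -/
noncomputable def occMulti (η' : Measure X) (π : MultiStrategy G) : Measure (X × JA A) :=
  ENNReal.ofReal (1 - G.α) •
    Measure.sum fun t : ℕ => ENNReal.ofReal G.α ^ t •
      ((histMeas G η' π t).bind fun h =>
        (jointLaw G π t h).map fun a => (lastState X (JA A) t h, a))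

end Occupation

section COP

/-- The product distribution on action profiles in state `x` in which player `i`
plays the fixed action `ai` and every player `j ≠ i` plays `φ j`. -/
noncomputable def statJoint (φ : StatProfile G) (i : Fin n) (x : X) (ai : A i) :
    Measure (JA A) :=
  Measure.pi fun j =>
    if h : j = i then Measure.dirac (cast (congrArg A h.symm) ai)
    else ((φ j).1 x : Measure (A j))

/-- `c_i^ℓ(x, [φ_{-i}(x), a_i])`. -/
noncomputable def cbar (φ : StatProfile G) (i : Fin n) (ℓ : Fin (l + 1)) (x : X)
    (ai : A i) : ℝ :=
  ∫ a, G.c i ℓ x a ∂(statJoint G φ i x ai)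

/-- `p(y | x, [φ_{-i}(x), a_i])`. -/
noncomputable def pbar (φ : StatProfile G) (i : Fin n) (y x : X) (ai : A i) : ℝ≥0∞ :=
  ∫⁻ a, G.p x a {y} ∂(statJoint G φ i x ai)

/-- Feasibility in the constrained optimisation problem `COP(φ_{-i})`:
`μ ∈ Pr(𝕂_i)` satisfies the constraint inequalities and the characteristic
equations of occupation measures. -/
def COPFeasible (φ : StatProfile G) (i : Fin n)
    (μ : ProbabilityMeasure (X × A i)) : Prop :=
  (μ : Measure (X × A i)) {q : X × A i | q.2 ∈ G.As i q.1} = 1 ∧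
  (∀ ℓ : Fin (l + 1), ℓ ≠ 0 →
    ∫ q : X × A i, cbar G φ i ℓ q.1 q.2 ∂(μ : Measure (X × A i)) ≤ G.κ i ℓ) ∧
  ∀ x : X, (μ : Measure (X × A i)) ({x} ×ˢ G.As i x) =
    ENNReal.ofReal (1 - G.α) * G.η {x} +
      ENNReal.ofReal G.α *
        ∫⁻ q : X × A i, pbar G φ i x q.1 q.2 ∂(μ : Measure (X × A i))

/-- The objective of `COP(φ_{-i})`. -/
noncomputable def COPObj (φ : StatProfile G) (i : Fin n)
    (μ : ProbabilityMeasure (X × A i)) : ℝ :=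
  ∫ q : X × A i, cbar G φ i 0 q.1 q.2 ∂(μ : Measure (X × A i))

/-- The solution set `𝓞_i(φ_{-i})` of `COP(φ_{-i})`. -/
def COPSol (φ : StatProfile G) (i : Fin n) : Set (ProbabilityMeasure (X × A i)) :=
  {μ | COPFeasible G φ i μ ∧
    ∀ ν, COPFeasible G φ i ν → COPObj G φ i μ ≤ COPObj G φ i ν}

end COP

section Perturbed

/-- `η̃` is a probability measure charging exactly the `η`-null states `X_0`. -/
def IsPerturb (ηt : Measure X) : Prop :=
  IsProbabilityMeasure ηt ∧ (∀ x, G.η {x} = 0 → 0 < ηt {x}) ∧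
    ∀ x, G.η {x} ≠ 0 → ηt {x} = 0

/-- The perturbed initial distribution `η(m) = (1 - 1/m) η + (1/m) η̃`. -/
noncomputable def etam (ηt : Measure X) (m : ℕ) : Measure X :=
  ENNReal.ofReal (1 - 1 / (m : ℝ)) • G.η + ENNReal.ofReal (1 / (m : ℝ)) • ηt

/-- The truncation `c_i^{ℓ,m}` of `c_i^ℓ` at the level `√m`. -/
noncomputable def ctrunc (i : Fin n) (ℓ : Fin (l + 1)) (m : ℕ) (x : X) (a : JA A) : ℝ :=
  max (-Real.sqrt m) (min (G.c i ℓ x a) (Real.sqrt m))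

/-- `J_i^{ℓ,η(m)}`: discounted cost with truncated costs and perturbed initial
distribution. -/
noncomputable def Jm (ηt : Measure X) (m : ℕ) (i : Fin n) (ℓ : Fin (l + 1))
    (π : MultiStrategy G) : ℝ :=
  Jfun G (etam G ηt m) (ctrunc G i ℓ m) π

/-- The perturbed constraint bounds `κ_i^{ℓ,m} = (1 - 1/m) κ_i^ℓ + 1/√m`. -/
noncomputable def kappam (i : Fin n) (ℓ : Fin (l + 1)) (m : ℕ) : ℝ :=
  (1 - 1 / (m : ℝ)) * G.κ i ℓ + 1 / Real.sqrt m

/-- `π_i ∈ Δ_i^m(π_{-i})` : the constraints of the `m`-CSG hold. -/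
def FeasM (ηt : Measure X) (m : ℕ) (i : Fin n) (π : MultiStrategy G) : Prop :=
  ∀ ℓ : Fin (l + 1), ℓ ≠ 0 → Jm G ηt m i ℓ π ≤ kappam G i ℓ m

end Perturbed

end CSGame

open CSGame

namespace CSGame

/-- probability vectors on a countable set -/
structure IsPV {X : Type} (f : X → ℝ) : Prop where
  nonneg : ∀ x, 0 ≤ f x
  hasSum : HasSum f 1

theorem IsPV.tsum_enorm {X : Type} {f : X → ℝ} (hf : IsPV f) : ∑' x, ‖f x‖ₑ = 1 := by
  have : ∀ x, ‖f x‖ₑ = ENNReal.ofReal (f x) := fun x => Real.enorm_of_nonneg (hf.nonneg x)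
  simp_rw [this]
  rw [← ENNReal.ofReal_tsum_of_nonneg hf.nonneg hf.hasSum.summable, hf.hasSum.tsum_eq]
  simp

theorem IsPV.summable_sub {X : Type} {f g : X → ℝ} (hf : IsPV f) (hg : IsPV g) :
    Summable fun x => |f x - g x| :=
  (hf.hasSum.summable.sub hg.hasSum.summable).abs

theorem IsPV.tsum_sub_le {X : Type} {f g : X → ℝ} (hf : IsPV f) (hg : IsPV g) :
    ∑' x, |f x - g x| ≤ 2 := by
  have h : ∑' x, |f x - g x| ≤ ∑' x, (f x + g x) := by
    refine (hf.summable_sub hg).tsum_le_tsum (fun x => ?_)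
      (hf.hasSum.summable.add hg.hasSum.summable)
    have := hf.nonneg x
    have := hg.nonneg x
    rw [abs_le]; constructor <;> linarith
  rw [(hf.hasSum.add hg.hasSum).tsum_eq] at h
  linarith

theorem scheffe {X T : Type} {F : Filter T} {f' : T → X → ℝ} {f : X → ℝ}
    (hf' : ∀ᶠ t in F, IsPV (f' t)) (hf : IsPV f)
    (h : ∀ x, Tendsto (fun t => f' t x) F (𝓝 (f x))) :
    Tendsto (fun t => ∑' x, |f' t x - f x|) F (𝓝 0) := by
  have h1 : Tendsto (fun t => ∑' x, (f x - min (f' t x) (f x))) F (𝓝 (∑' x : X, (0:ℝ))) := by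
    refine tendsto_tsum_of_dominated_convergence hf.hasSum.summable (fun x => ?_) ?_
    · have := (tendsto_const_nhds (x := f x)).sub ((h x).min (tendsto_const_nhds (x := f x)))
      simpa using this
    · filter_upwards [hf'] with t ht x
      have h1 := ht.nonneg x
      have h2 := hf.nonneg x
      rw [Real.norm_of_nonneg (by have := min_le_right (f' t x) (f x); linarith)]
      have : 0 ≤ min (f' t x) (f x) := le_min h1 h2
      linarith
  have h2 := h1.const_mul 2
  simp only [tsum_zero, mul_zero] at h2
  refine h2.congr' ?_
  filter_upwards [hf'] with t ht
  have hs : Summable fun x => min (f' t x) (f x) :=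
    Summable.of_nonneg_of_le (fun x => le_min (ht.nonneg x) (hf.nonneg x))
      (fun x => min_le_right _ _) hf.hasSum.summable
  have e : ∀ x, |f' t x - f x| = (f' t x - f x) + 2 * (f x - min (f' t x) (f x)) := by
    intro x
    rcases le_total (f' t x) (f x) with hx | hx
    · rw [min_eq_left hx, abs_of_nonpos (by linarith)]; ring
    · rw [min_eq_right hx, abs_of_nonneg (by linarith)]; ring
  simp_rw [e]
  rw [Summable.tsum_add (ht.hasSum.summable.sub hf.hasSum.summable)
    ((hf.hasSum.summable.sub hs).mul_left 2), (ht.hasSum.sub hf.hasSum).tsum_eq, tsum_mul_left]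
  ring

theorem tendsto_tsum_pv {X T : Type} {F : Filter T} {f' : T → X → ℝ} {f : X → ℝ}
    {g' : T → X → ℝ} {g : X → ℝ} {C : ℝ}
    (hf' : ∀ᶠ t in F, IsPV (f' t)) (hf : IsPV f)
    (h : Tendsto (fun t => ∑' x, |f' t x - f x|) F (𝓝 0))
    (hg : ∀ x, Tendsto (fun t => g' t x) F (𝓝 (g x)))
    (hgb : ∀ t x, |g' t x| ≤ C) :
    Tendsto (fun t => ∑' x, f' t x * g' t x) F (𝓝 (∑' x, f x * g x)) := by
  have h1 : Tendsto (fun t => ∑' x, f x * g' t x) F (𝓝 (∑' x, f x * g x)) := by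
    refine tendsto_tsum_of_dominated_convergence (hf.hasSum.summable.mul_right C)
      (fun x => (hg x).const_mul _) (Eventually.of_forall fun t x => ?_)
    rw [norm_mul, Real.norm_of_nonneg (hf.nonneg x)]
    exact mul_le_mul_of_nonneg_left (hgb t x) (hf.nonneg x)
  have h2 : Tendsto (fun t => ∑' x, (f' t x - f x) * g' t x) F (𝓝 0) := by
    refine squeeze_zero_norm' (a := fun t => (∑' x, |f' t x - f x|) * C) ?_
      (by simpa using h.mul_const C)
    filter_upwards [hf'] with t ht
    rw [← tsum_mul_right]
    refine tsum_of_norm_bounded ((ht.summable_sub hf).mul_right C).hasSum fun x => ?_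
    rw [norm_mul, Real.norm_eq_abs]
    exact mul_le_mul_of_nonneg_left (hgb t x) (abs_nonneg _)
  have h3 := h1.add h2
  rw [add_zero] at h3
  refine h3.congr' ?_
  filter_upwards [hf'] with t ht
  have s1 : Summable fun x => f x * g' t x := by
    refine Summable.of_norm_bounded (hf.hasSum.summable.mul_right C) fun x => ?_
    rw [norm_mul, Real.norm_of_nonneg (hf.nonneg x)]
    exact mul_le_mul_of_nonneg_left (hgb t x) (hf.nonneg x)
  have s2 : Summable fun x => (f' t x - f x) * g' t x := by
    refine Summable.of_norm_bounded ((ht.summable_sub hf).mul_right C) fun x => ?_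
    rw [norm_mul, Real.norm_eq_abs]
    exact mul_le_mul_of_nonneg_left (hgb t x) (abs_nonneg _)
  rw [← s1.tsum_add s2]
  congr 1; ext x; ring

/-- `m` is the stationary solution of the characteristic equation of the kernel `P`. -/
structure IsFix {X : Type} (α : ℝ) (e : X → ℝ) (P : X → X → ℝ) (m : X → ℝ) : Prop where
  pv : IsPV m
  eq : ∀ y, m y = (1 - α) * e y + α * ∑' x, m x * P x y

theorem IsPV.le_one {X : Type} {f : X → ℝ} (hf : IsPV f) (x : X) : f x ≤ 1 :=
  le_hasSum hf.hasSum x (fun y _ => hf.nonneg y)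

theorem IsPV.summable_mul {X : Type} {f : X → ℝ} (hf : IsPV f) {g : X → ℝ} {C : ℝ}
    (hg : ∀ x, |g x| ≤ C) : Summable fun x => f x * g x := by
  refine Summable.of_norm_bounded (hf.hasSum.summable.mul_right C) fun x => ?_
  rw [norm_mul, Real.norm_of_nonneg (hf.nonneg x)]
  exact mul_le_mul_of_nonneg_left (hg x) (hf.nonneg x)

theorem fix_est {X : Type} {α : ℝ} (h0 : 0 < α) (_h1 : α < 1) {e : X → ℝ}
    {P P' : X → X → ℝ} {m m' : X → ℝ} (hP : ∀ x, IsPV (P x)) (hP' : ∀ x, IsPV (P' x))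
    (hm : IsFix α e P m) (hm' : IsFix α e P' m') :
    (1 - α) * ∑' x, |m' x - m x| ≤ α * ∑' x, m x * ∑' y, |P' x y - P x y| := by
  have ha : ∀ {P : X → X → ℝ}, (∀ x, IsPV (P x)) → ∀ x y, |P x y| ≤ 1 := fun hP x y => by
    rw [abs_of_nonneg ((hP x).nonneg y)]; exact (hP x).le_one y
  set D : ℝ≥0∞ := ∑' y, ‖m' y - m y‖ₑ with hD
  set R : ℝ≥0∞ := ∑' x, ‖m x‖ₑ * ∑' y, ‖P' x y - P x y‖ₑ with hR
  have key : D ≤ ENNReal.ofReal α * D + ENNReal.ofReal α * R := by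
    have hy : ∀ y, ‖m' y - m y‖ₑ ≤ ENNReal.ofReal α * ∑' x, ‖m' x - m x‖ₑ * ‖P' x y‖ₑ
        + ENNReal.ofReal α * ∑' x, ‖m x‖ₑ * ‖P' x y - P x y‖ₑ := by
      intro y
      have s1 := hm'.pv.summable_mul (fun x => ha hP' x y)
      have s2 := hm.pv.summable_mul (fun x => ha hP x y)
      have s3 := hm.pv.summable_mul (fun x => ha hP' x y)
      have : m' y - m y = α * ∑' x, (m' x - m x) * P' x y
          + α * ∑' x, m x * (P' x y - P x y) := by
        rw [hm'.eq y, hm.eq y]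
        simp_rw [sub_mul, mul_sub]
        rw [s1.tsum_sub s3, s3.tsum_sub s2]; ring
      rw [this]
      refine (enorm_add_le _ _).trans ?_
      rw [enorm_mul, enorm_mul, Real.enorm_of_nonneg h0.le]
      gcongr
      · refine enorm_tsum_le_tsum_enorm.trans_eq ?_
        simp_rw [enorm_mul]
      · refine enorm_tsum_le_tsum_enorm.trans_eq ?_
        simp_rw [enorm_mul]
    refine (ENNReal.tsum_le_tsum hy).trans_eq ?_
    rw [ENNReal.tsum_add, ENNReal.tsum_mul_left, ENNReal.tsum_mul_left, ENNReal.tsum_comm,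
      ENNReal.tsum_comm (f := fun y x => ‖m x‖ₑ * ‖P' x y - P x y‖ₑ)]
    simp_rw [ENNReal.tsum_mul_left, (hP' _).tsum_enorm, mul_one]
    rfl
  have eD : D = ENNReal.ofReal (∑' x, |m' x - m x|) := by
    rw [ENNReal.ofReal_tsum_of_nonneg (fun _ => abs_nonneg _) (hm'.pv.summable_sub hm.pv)]
    simp_rw [hD, ← Real.enorm_eq_ofReal_abs]
  have eR : R = ENNReal.ofReal (∑' x, m x * ∑' y, |P' x y - P x y|) := by
    have hn : ∀ x, 0 ≤ ∑' y, |P' x y - P x y| := fun x => tsum_nonneg fun _ => abs_nonneg _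
    rw [ENNReal.ofReal_tsum_of_nonneg (fun x => mul_nonneg (hm.pv.nonneg x) (hn x))
      (hm.pv.summable_mul (C := 2) fun x => by
        rw [abs_of_nonneg (hn x)]; exact (hP' x).tsum_sub_le (hP x))]
    rw [hR]
    congr 1; ext x
    rw [ENNReal.ofReal_mul (hm.pv.nonneg x), ENNReal.ofReal_tsum_of_nonneg
      (fun _ => abs_nonneg _) ((hP' x).summable_sub (hP x)), Real.enorm_of_nonneg (hm.pv.nonneg x)]
    simp_rw [← Real.enorm_eq_ofReal_abs]
  have nD : 0 ≤ ∑' x, |m' x - m x| := tsum_nonneg fun _ => abs_nonneg _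
  have nR : 0 ≤ ∑' x, m x * ∑' y, |P' x y - P x y| :=
    tsum_nonneg fun x => mul_nonneg (hm.pv.nonneg x) (tsum_nonneg fun _ => abs_nonneg _)
  rw [eD, eR, ← ENNReal.ofReal_mul h0.le, ← ENNReal.ofReal_mul h0.le,
    ← ENNReal.ofReal_add (by positivity) (by positivity),
    ENNReal.ofReal_le_ofReal_iff (by positivity)] at key
  linarith

theorem fix_tendsto {X T : Type} {F : Filter T} {α : ℝ} (h0 : 0 < α) (h1 : α < 1) {e : X → ℝ}
    {P : X → X → ℝ} {P' : T → X → X → ℝ} {m : X → ℝ} {m' : T → X → ℝ}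
    (hP : ∀ x, IsPV (P x)) (hP' : ∀ t x, IsPV (P' t x))
    (hm : IsFix α e P m) (hm' : ∀ᶠ t in F, IsFix α e (P' t) (m' t))
    (h : ∀ x y, Tendsto (fun t => P' t x y) F (𝓝 (P x y))) :
    Tendsto (fun t => ∑' x, |m' t x - m x|) F (𝓝 0) := by
  have hx : ∀ x, Tendsto (fun t => ∑' y, |P' t x y - P x y|) F (𝓝 0) := fun x =>
    scheffe (Eventually.of_forall fun t => hP' t x) (hP x) (h x)
  have h2 : Tendsto (fun t => ∑' x, m x * ∑' y, |P' t x y - P x y|) F (𝓝 (∑' x, m x * 0)) := by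
    refine tendsto_tsum_of_dominated_convergence (hm.pv.hasSum.summable.mul_right 2)
      (fun x => (hx x).const_mul _) (Eventually.of_forall fun t x => ?_)
    have hn : 0 ≤ ∑' y, |P' t x y - P x y| := tsum_nonneg fun _ => abs_nonneg _
    rw [Real.norm_of_nonneg (mul_nonneg (hm.pv.nonneg x) hn)]
    exact mul_le_mul_of_nonneg_left ((hP' t x).tsum_sub_le (hP x)) (hm.pv.nonneg x)
  have h3 := (h2.const_mul α).div_const (1 - α)
  simp only [mul_zero, tsum_zero, zero_div] at h3
  refine squeeze_zero' (Eventually.of_forall fun t => tsum_nonneg fun _ => abs_nonneg _) ?_ h3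
  filter_upwards [hm'] with t ht
  rw [le_div_iff₀ (by linarith), mul_comm]
  exact fix_est h0 h1 hP (hP' t) hm ht

theorem tendsto_of_tsum_abs {X T : Type} {F : Filter T} {m : X → ℝ} {m' : T → X → ℝ}
    (hm : IsPV m) (hm' : ∀ᶠ t in F, IsPV (m' t))
    (h : Tendsto (fun t => ∑' x, |m' t x - m x|) F (𝓝 0)) (x : X) :
    Tendsto (fun t => m' t x) F (𝓝 (m x)) := by
  rw [tendsto_iff_norm_sub_tendsto_zero]
  refine squeeze_zero' (Eventually.of_forall fun t => norm_nonneg _) ?_ h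
  filter_upwards [hm'] with t ht
  exact (ht.summable_sub hm).le_tsum x (fun _ _ => abs_nonneg _)

theorem fix_unique {X : Type} {α : ℝ} (h0 : 0 < α) (h1 : α < 1) {e : X → ℝ}
    {P : X → X → ℝ} {m m' : X → ℝ} (hP : ∀ x, IsPV (P x))
    (hm : IsFix α e P m) (hm' : IsFix α e P m') : m' = m := by
  have h := fix_est h0 h1 hP hP hm hm'
  simp only [sub_self, abs_zero, tsum_zero, mul_zero] at h
  have nD : 0 ≤ ∑' x, |m' x - m x| := tsum_nonneg fun _ => abs_nonneg _
  have hz : ∑' x, |m' x - m x| = 0 := by nlinarith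
  ext x
  have := (hm'.pv.summable_sub hm.pv).le_tsum x (fun _ _ => abs_nonneg _)
  rw [hz] at this
  have := abs_nonpos_iff.1 this
  linarith

end CSGame

namespace CSGame

set_option linter.unusedSectionVars false

section Mix
variable {X : Type} [Countable X] [MeasurableSpace X] [DiscreteMeasurableSpace X]
variable {B : Type} [MeasurableSpace B]

/-- the mixture measure on pairs -/
noncomputable def mixM (m : X → ℝ) (γ : X → ProbabilityMeasure B) : Measure (X × B) :=
  Measure.sum fun x => ENNReal.ofReal (m x) • ((γ x : Measure B).map (Prod.mk x))

theorem lintegral_mixM (m : X → ℝ) (γ : X → ProbabilityMeasure B) {f : X × B → ℝ≥0∞}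
    (hf : Measurable f) :
    ∫⁻ q, f q ∂(mixM m γ) = ∑' x, ENNReal.ofReal (m x) * ∫⁻ b, f (x, b) ∂(γ x : Measure B) := by
  rw [mixM, lintegral_sum_measure]
  congr 1; ext x
  rw [lintegral_smul_measure, lintegral_map hf measurable_prodMk_left, smul_eq_mul]

theorem mixM_apply (m : X → ℝ) (γ : X → ProbabilityMeasure B) (x : X) {s : Set B}
    (hs : MeasurableSet s) :
    mixM m γ ({x} ×ˢ s) = ENNReal.ofReal (m x) * (γ x : Measure B) s := by
  have hm : MeasurableSet (({x} : Set X) ×ˢ s) := (MeasurableSet.of_discrete).prod hs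
  rw [← lintegral_indicator_one hm, lintegral_mixM _ _ (measurable_one.indicator hm),
    tsum_eq_single x]
  · congr 1
    have : ∀ b, (({x} : Set X) ×ˢ s).indicator (1 : X × B → ℝ≥0∞) (x, b)
        = s.indicator 1 b := by
      intro b; by_cases hb : b ∈ s <;> simp [hb]
    simp_rw [this]
    rw [lintegral_indicator_one hs]
  · intro y hy
    have : ∀ b, (({x} : Set X) ×ˢ s).indicator (1 : X × B → ℝ≥0∞) (y, b) = 0 := by
      intro b; simp [hy]
    simp [this]

theorem mixM_prob {m : X → ℝ} (hm : IsPV m) (γ : X → ProbabilityMeasure B) :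
    IsProbabilityMeasure (mixM m γ) := by
  constructor
  rw [← lintegral_one, lintegral_mixM _ _ measurable_const]
  simp only [lintegral_one, measure_univ, mul_one]
  rw [← ENNReal.ofReal_tsum_of_nonneg hm.nonneg hm.hasSum.summable, hm.hasSum.tsum_eq]
  simp

theorem integral_mixM {m : X → ℝ} (hm : IsPV m) (γ : X → ProbabilityMeasure B)
    {f : X × B → ℝ} (hf : Measurable f) {C : ℝ} (hC : ∀ q, |f q| ≤ C) :
    ∫ q, f q ∂(mixM m γ) = ∑' x, m x * ∫ b, f (x, b) ∂(γ x : Measure B) := by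
  have := mixM_prob hm γ
  have hi : Integrable f (mixM m γ) :=
    Integrable.of_bound hf.aestronglyMeasurable C (Eventually.of_forall hC)
  rw [mixM] at hi ⊢
  rw [integral_sum_measure hi]
  congr 1; ext x
  rw [integral_smul_measure, integral_map measurable_prodMk_left.aemeasurable
    hf.aestronglyMeasurable, ENNReal.toReal_ofReal (hm.nonneg x), smul_eq_mul]

/-- two measures on `X × B` agreeing on slices are equal -/
theorem ext_slices {μ ν : Measure (X × B)}
    (h : ∀ x (s : Set B), MeasurableSet s → μ ({x} ×ˢ s) = ν ({x} ×ˢ s)) : μ = ν := by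
  ext S hS
  have hS' : S = ⋃ x : X, ({x} : Set X) ×ˢ (Prod.mk x ⁻¹' S) := by
    ext ⟨x, b⟩; simp
  have hd : Pairwise (Function.onFun Disjoint fun x : X => ({x} : Set X) ×ˢ (Prod.mk x ⁻¹' S)) := by
    intro x y hxy
    rw [Function.onFun, Set.disjoint_left]
    rintro ⟨z, b⟩ h1 h2
    simp only [Set.mem_prod, Set.mem_singleton_iff] at h1 h2
    exact hxy (h1.1.symm.trans h2.1)
  have hmeas : ∀ x, MeasurableSet (({x} : Set X) ×ˢ (Prod.mk x ⁻¹' S)) := fun x =>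
    (MeasurableSet.of_discrete).prod (measurable_prodMk_left hS)
  rw [hS', measure_iUnion hd hmeas, measure_iUnion hd hmeas]
  congr 1; ext x
  exact h x _ (measurable_prodMk_left hS)

end Mix

section PiUpd
variable {n : ℕ} {A : Fin n → Type} [∀ i, MeasurableSpace (A i)]

theorem measurable_upd (i : Fin n) :
    Measurable fun q : A i × JA A => (Function.update q.2 i q.1 : JA A) := by
  rw [measurable_pi_iff]
  intro j
  by_cases h : j = i
  · subst h; simpa using measurable_fst
  · simp only [Function.update_of_ne h]
    exact (measurable_pi_apply j).comp measurable_snd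

theorem upd_prob (μ : ∀ j, Measure (A j)) [∀ j, IsProbabilityMeasure (μ j)] (i : Fin n)
    (ν : Measure (A i)) [IsProbabilityMeasure ν] (j : Fin n) :
    IsProbabilityMeasure (Function.update μ i ν j) := by
  by_cases h : j = i
  · subst h; simpa
  · rw [Function.update_of_ne h]; infer_instance

theorem pi_update (μ : ∀ j, Measure (A j)) [∀ j, IsProbabilityMeasure (μ j)] (i : Fin n)
    (ν : Measure (A i)) [IsProbabilityMeasure ν] :
    Measure.pi (Function.update μ i ν) =
      (ν.prod (Measure.pi μ)).map (fun q => (Function.update q.2 i q.1 : JA A)) := by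
  have := upd_prob μ i ν
  refine Measure.pi_eq fun s hs => ?_
  rw [Measure.map_apply (measurable_upd i) (MeasurableSet.univ_pi hs)]
  have hpre : (fun q : A i × JA A => (Function.update q.2 i q.1 : JA A)) ⁻¹' (Set.univ.pi s)
      = s i ×ˢ Set.univ.pi (Function.update s i Set.univ) := by
    ext ⟨b, a⟩
    simp only [Set.mem_preimage, Set.mem_pi, Set.mem_univ, true_implies, Set.mem_prod]
    constructor
    · intro h
      refine ⟨by simpa using h i, fun j => ?_⟩
      by_cases hj : j = i
      · subst hj; simp
      · have := h j
        rw [Function.update_of_ne hj] at this ⊢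
        exact this
    · rintro ⟨h1, h2⟩ j
      by_cases hj : j = i
      · subst hj; simpa using h1
      · have := h2 j
        rw [Function.update_of_ne hj] at this ⊢
        exact this
  rw [hpre, Measure.prod_prod, Measure.pi_pi, Fintype.prod_eq_mul_prod_compl i,
    Fintype.prod_eq_mul_prod_compl i]
  simp only [Function.update_self, measure_univ, one_mul]
  congr 1
  refine Finset.prod_congr rfl fun j hj => ?_
  have hj : j ≠ i := by simpa using hj
  rw [Function.update_of_ne hj, Function.update_of_ne hj]

theorem pi_update_dirac (μ : ∀ j, Measure (A j)) [∀ j, IsProbabilityMeasure (μ j)] (i : Fin n)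
    (b : A i) :
    Measure.pi (Function.update μ i (Measure.dirac b)) =
      (Measure.pi μ).map (fun a => (Function.update a i b : JA A)) := by
  rw [pi_update, Measure.dirac_prod, Measure.map_map (measurable_upd i) measurable_prodMk_left]
  rfl

theorem lintegral_pi_update (μ : ∀ j, Measure (A j)) [∀ j, IsProbabilityMeasure (μ j)] (i : Fin n)
    (ν : Measure (A i)) [IsProbabilityMeasure ν] {f : JA A → ℝ≥0∞} (hf : Measurable f) :
    ∫⁻ a, f a ∂(Measure.pi (Function.update μ i ν)) =
      ∫⁻ b, ∫⁻ a, f (Function.update a i b) ∂(Measure.pi μ) ∂ν := by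
  rw [pi_update, lintegral_map hf (measurable_upd i),
    lintegral_prod (fun q : A i × JA A => f (Function.update q.2 i q.1))
      (hf.comp (measurable_upd i)).aemeasurable]

theorem integral_pi_update (μ : ∀ j, Measure (A j)) [∀ j, IsProbabilityMeasure (μ j)] (i : Fin n)
    (ν : Measure (A i)) [IsProbabilityMeasure ν] {f : JA A → ℝ} (hf : Measurable f)
    {C : ℝ} (hC : ∀ a, |f a| ≤ C) :
    ∫ a, f a ∂(Measure.pi (Function.update μ i ν)) =
      ∫ b, ∫ a, f (Function.update a i b) ∂(Measure.pi μ) ∂ν := by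
  rw [pi_update, integral_map (measurable_upd i).aemeasurable hf.aestronglyMeasurable,
    integral_prod]
  exact Integrable.of_bound (hf.comp (measurable_upd i)).aestronglyMeasurable C
    (Eventually.of_forall fun q => hC _)

theorem abs_integral_le {Ω : Type} [MeasurableSpace Ω] (μ : Measure Ω) [IsProbabilityMeasure μ]
    {f : Ω → ℝ} {C : ℝ} (hC : ∀ a, |f a| ≤ C) : |∫ a, f a ∂μ| ≤ C := by
  have := norm_integral_le_of_norm_le_const (μ := μ) (f := f) (C := C) (Eventually.of_forall hC)
  simpa using this

end PiUpd

section Prof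
variable {n l : ℕ}
variable {X : Type} [Countable X] [MeasurableSpace X] [DiscreteMeasurableSpace X]
  [TopologicalSpace X] [DiscreteTopology X] [BorelSpace X] [SecondCountableTopology X]
variable {A : Fin n → Type} [∀ i, MeasurableSpace (A i)] [∀ i, TopologicalSpace (A i)]
  [∀ i, PolishSpace (A i)] [∀ i, BorelSpace (A i)]
variable (G : GameData n l X A)

/-- product law of a stationary profile -/
noncomputable def piS (ψ : StatProfile G) (x : X) : Measure (JA A) :=
  Measure.pi fun j => ((ψ j).1 x : Measure (A j))

instance (ψ : StatProfile G) (x : X) : IsProbabilityMeasure (piS G ψ x) := by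
  unfold piS; infer_instance

theorem As_closed (i : Fin n) (x : X) : IsClosed (G.As i x) := (G.hAs_cpt i x).isClosed

theorem As_meas (i : Fin n) (x : X) : MeasurableSet (G.As i x) := (As_closed G i x).measurableSet

theorem jointSet_closed (x : X) : IsClosed (jointSet G x) :=
  isClosed_set_pi fun i _ => As_closed G i x

theorem jointSet_meas (x : X) : MeasurableSet (jointSet G x) := (jointSet_closed G x).measurableSet

theorem stat_supp {i : Fin n} (φ : Stat G i) (x : X) : (φ.1 x : Measure (A i)) (G.As i x) = 1 := by
  have := φ.2 x
  rw [← ProbabilityMeasure.ennreal_coeFn_eq_coeFn_toMeasure, this]; rfl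

theorem piS_jointSet (ψ : StatProfile G) (x : X) : piS G ψ x (jointSet G x) = 1 := by
  rw [piS, jointSet, Measure.pi_pi]
  simp [stat_supp]

theorem piS_upd (φ : StatProfile G) (i : Fin n) (γ : Stat G i) (x : X) :
    piS G (updStat G φ i γ) x =
      Measure.pi (Function.update (fun j => ((φ j).1 x : Measure (A j))) i (γ.1 x : Measure (A i))) := by
  unfold piS updStat
  congr 1; ext1 j
  by_cases h : j = i
  · subst h; simp
  · simp [Function.update_of_ne h]

theorem statJoint_eq (φ : StatProfile G) (i : Fin n) (x : X) (b : A i) :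
    statJoint G φ i x b = (piS G φ x).map (fun a => (Function.update a i b : JA A)) := by
  rw [piS, ← pi_update_dirac]
  unfold statJoint
  congr 1; ext1 j
  by_cases h : j = i
  · subst h; simp
  · simp [h]

theorem measurable_upd_left (i : Fin n) (b : A i) :
    Measurable fun a : JA A => (Function.update a i b : JA A) :=
  (measurable_upd i).comp measurable_prodMk_left

instance (φ : StatProfile G) (i : Fin n) (x : X) (b : A i) :
    IsProbabilityMeasure (statJoint G φ i x b) := by
  rw [statJoint_eq]
  exact Measure.isProbabilityMeasure_map (measurable_upd_left i b).aemeasurable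

theorem cbar_eq (φ : StatProfile G) (i : Fin n) (ℓ : Fin (l + 1)) (x : X) (b : A i) :
    cbar G φ i ℓ x b = ∫ a, G.c i ℓ x (Function.update a i b) ∂(piS G φ x) := by
  rw [cbar, statJoint_eq, integral_map (measurable_upd_left i b).aemeasurable
    (G.hc i ℓ x).aestronglyMeasurable]

theorem pbar_eq (φ : StatProfile G) (i : Fin n) (y x : X) (b : A i) :
    pbar G φ i y x b = ∫⁻ a, G.p x (Function.update a i b) {y} ∂(piS G φ x) := by
  rw [pbar, statJoint_eq, lintegral_map (G.hpm x y) (measurable_upd_left i b)]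

theorem measurable_cbar (φ : StatProfile G) (i : Fin n) (ℓ : Fin (l + 1)) :
    Measurable fun q : X × A i => cbar G φ i ℓ q.1 q.2 := by
  refine measurable_from_prod_countable_right fun x => ?_
  simp only [cbar_eq]
  exact (StronglyMeasurable.integral_prod_right (ν := piS G φ x)
    (f := fun (b : A i) a => G.c i ℓ x (Function.update a i b))
    (((G.hc i ℓ x).comp (measurable_upd i)).stronglyMeasurable)).measurable

theorem measurable_pbar (φ : StatProfile G) (i : Fin n) (y : X) :
    Measurable fun q : X × A i => pbar G φ i y q.1 q.2 := by
  refine measurable_from_prod_countable_right fun x => ?_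
  simp only [pbar_eq]
  exact Measurable.lintegral_prod_right' (ν := piS G φ x)
    (f := fun q : A i × JA A => G.p x (Function.update q.2 i q.1) {y})
    ((G.hpm x y).comp (measurable_upd i))

theorem abs_cbar_le (φ : StatProfile G) (i : Fin n) (ℓ : Fin (l + 1)) {C : ℝ}
    (hC : ∀ x a, |G.c i ℓ x a| ≤ C) (x : X) (b : A i) : |cbar G φ i ℓ x b| ≤ C :=
  abs_integral_le _ (hC x)

/-- one-step expected cost under a stationary profile -/
noncomputable def Cm (i : Fin n) (ℓ : Fin (l + 1)) (ψ : StatProfile G) (x : X) : ℝ :=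
  ∫ a, G.c i ℓ x a ∂(piS G ψ x)

/-- transition matrix of a stationary profile -/
noncomputable def Pm (ψ : StatProfile G) (x y : X) : ℝ :=
  ∫ a, (G.p x a {y}).toReal ∂(piS G ψ x)

theorem integral_cbar (φ : StatProfile G) (i : Fin n) (ℓ : Fin (l + 1)) {C : ℝ}
    (hC : ∀ x a, |G.c i ℓ x a| ≤ C) (γ : Stat G i) (x : X) :
    ∫ b, cbar G φ i ℓ x b ∂(γ.1 x : Measure (A i)) = Cm G i ℓ (updStat G φ i γ) x := by
  rw [Cm, piS_upd, integral_pi_update _ _ _ (G.hc i ℓ x) (hC x)]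
  simp_rw [cbar_eq]; rfl

theorem p_le_one (x y : X) (a : JA A) : G.p x a {y} ≤ 1 := by
  have := G.hp x a
  exact prob_le_one

theorem ofReal_Pm (ψ : StatProfile G) (x y : X) :
    ENNReal.ofReal (Pm G ψ x y) = ∫⁻ a, G.p x a {y} ∂(piS G ψ x) := by
  rw [Pm, integral_toReal (G.hpm x y).aemeasurable
    (Eventually.of_forall fun a => (p_le_one G x y a).trans_lt ENNReal.one_lt_top),
    ENNReal.ofReal_toReal]
  refine ne_top_of_le_ne_top (b := 1) ENNReal.one_ne_top ?_
  calc _ ≤ ∫⁻ a, 1 ∂(piS G ψ x) := lintegral_mono fun a => p_le_one G x y a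
    _ = 1 := by simp

theorem lintegral_pbar (φ : StatProfile G) (i : Fin n) (γ : Stat G i) (x y : X) :
    ∫⁻ b, pbar G φ i y x b ∂(γ.1 x : Measure (A i)) =
      ENNReal.ofReal (Pm G (updStat G φ i γ) x y) := by
  rw [ofReal_Pm, piS_upd, lintegral_pi_update _ _ _ (G.hpm x y)]
  simp_rw [pbar_eq]; rfl

theorem tsum_p (x : X) (a : JA A) : ∑' y, G.p x a {y} = 1 := by
  have := G.hp x a
  rw [← measure_univ (μ := G.p x a), ← lintegral_one, lintegral_countable']
  simp

theorem Pm_nonneg (ψ : StatProfile G) (x y : X) : 0 ≤ Pm G ψ x y :=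
  integral_nonneg fun _ => ENNReal.toReal_nonneg

theorem isPV_of_tsum {f : X → ℝ} (h0 : ∀ x, 0 ≤ f x) (h : ∑' x, ENNReal.ofReal (f x) = 1) :
    IsPV f := by
  refine ⟨h0, ?_⟩
  have hs : Summable f := by
    have := ENNReal.summable_toReal (f := fun x => ENNReal.ofReal (f x)) (by rw [h]; simp)
    simpa [ENNReal.toReal_ofReal (h0 _)] using this
  have h2 : ENNReal.ofReal (∑' x, f x) = 1 := by
    rw [ENNReal.ofReal_tsum_of_nonneg h0 hs, h]
  have h3 : ∑' x, f x = 1 := by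
    have := congrArg ENNReal.toReal h2
    rwa [ENNReal.toReal_ofReal (tsum_nonneg h0), ENNReal.toReal_one] at this
  rw [← h3]; exact hs.hasSum

theorem Pm_pv (ψ : StatProfile G) (x : X) : IsPV (Pm G ψ x) := by
  refine isPV_of_tsum (fun y => Pm_nonneg G ψ x y) ?_
  simp_rw [ofReal_Pm]
  rw [← lintegral_tsum fun y => (G.hpm x y).aemeasurable]
  simp_rw [tsum_p]
  simp

theorem tendsto_piS {T : Type} {F : Filter T} {ψ' : T → StatProfile G} {ψ : StatProfile G}
    (h : ∀ j x, Tendsto (fun t => (ψ' t j).1 x) F (𝓝 ((ψ j).1 x))) (x : X)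
    {f : JA A → ℝ} {C : ℝ} (hC : ∀ a, |f a| ≤ C)
    (hf : ContinuousOn f (jointSet G x)) :
    Tendsto (fun t => ∫ a, f a ∂(piS G (ψ' t) x)) F (𝓝 (∫ a, f a ∂(piS G ψ x))) := by
  let g : BoundedContinuousFunction (jointSet G x) ℝ :=
    BoundedContinuousFunction.ofNormedAddCommGroup (fun a => f a)
      (continuousOn_iff_continuous_domRestrict.1 hf) C (fun a => hC a)
  obtain ⟨k, -, hk⟩ := BoundedContinuousFunction.exists_norm_eq_domRestrict_eq_of_closed g
    (jointSet_closed G x)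
  have hk' : ∀ ψ : StatProfile G, ∫ a, f a ∂(piS G ψ x) = ∫ a, k a ∂(piS G ψ x) := by
    intro ψ
    refine integral_congr_ae ?_
    have : ∀ᵐ a ∂(piS G ψ x), a ∈ jointSet G x := by
      exact (mem_ae_iff_prob_eq_one (jointSet_meas G x)).2 (piS_jointSet G ψ x)
    filter_upwards [this] with a ha
    have := DFunLike.congr_fun hk ⟨a, ha⟩
    exact this.symm
  simp_rw [hk']
  have hp : Tendsto (fun t => ProbabilityMeasure.pi fun j => (ψ' t j).1 x) F
      (𝓝 (ProbabilityMeasure.pi fun j => (ψ j).1 x)) :=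
    (ProbabilityMeasure.continuous_pi.tendsto _).comp
      (tendsto_pi_nhds.2 fun j => h j x)
  exact (ProbabilityMeasure.tendsto_iff_forall_integral_tendsto.1 hp) k

theorem tendsto_Cm (hA : AssumptionA G) {T : Type} {F : Filter T} {ψ' : T → StatProfile G}
    {ψ : StatProfile G} {i : Fin n} {ℓ : Fin (l + 1)} {C : ℝ} (hC : ∀ x a, |G.c i ℓ x a| ≤ C)
    (h : ∀ j x, Tendsto (fun t => (ψ' t j).1 x) F (𝓝 ((ψ j).1 x))) (x : X) :
    Tendsto (fun t => Cm G i ℓ (ψ' t) x) F (𝓝 (Cm G i ℓ ψ x)) :=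
  tendsto_piS G h x (hC x) (hA.2 i ℓ x)

theorem tendsto_Pm (hA : AssumptionA G) {T : Type} {F : Filter T} {ψ' : T → StatProfile G}
    {ψ : StatProfile G}
    (h : ∀ j x, Tendsto (fun t => (ψ' t j).1 x) F (𝓝 ((ψ j).1 x))) (x y : X) :
    Tendsto (fun t => Pm G (ψ' t) x y) F (𝓝 (Pm G ψ x y)) := by
  refine tendsto_piS G (C := 1) h x (fun a => ?_) ?_
  · rw [abs_of_nonneg ENNReal.toReal_nonneg]
    exact ENNReal.toReal_le_of_le_ofReal zero_le_one (by simpa using p_le_one G x y a)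
  · exact ENNReal.continuousOn_toReal.comp (hA.1 x y) fun a _ =>
      (p_le_one G x y a).trans_lt ENNReal.one_lt_top |>.ne

end Prof
end CSGame

namespace CSGame

set_option linter.unusedSectionVars false

section Gen
variable {α β γ : Type} [MeasurableSpace α] [MeasurableSpace β] [MeasurableSpace γ]

theorem meas_lint {κ : α → Measure β} (hκ : Measurable κ) (hp : ∀ a, IsProbabilityMeasure (κ a))
    {f : α × β → ℝ≥0∞} (hf : Measurable f) : Measurable fun a => ∫⁻ b, f (a, b) ∂(κ a) := by
  let k : Kernel α β := ⟨κ, hκ⟩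
  have : IsMarkovKernel k := ⟨hp⟩
  exact Measurable.lintegral_kernel_prod_right' (κ := k) hf

theorem meas_map {κ : α → Measure β} (hκ : Measurable κ) (hp : ∀ a, IsProbabilityMeasure (κ a))
    {g : α × β → γ} (hg : Measurable g) : Measurable fun a => (κ a).map (fun b => g (a, b)) := by
  let k : Kernel α β := ⟨κ, hκ⟩
  have : IsMarkovKernel k := ⟨hp⟩
  refine Measure.measurable_of_measurable_coe _ fun s hs => ?_
  have : ∀ a, (κ a).map (fun b => g (a, b)) s = k a (Prod.mk a ⁻¹' (g ⁻¹' s)) := fun a => by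
    have hga : Measurable fun b => g (a, b) := hg.comp measurable_prodMk_left
    rw [Measure.map_apply hga hs]; rfl
  simp_rw [this]
  exact Kernel.measurable_kernel_prodMk_left (hg hs)

theorem meas_bind {κ : α → Measure β} (hκ : Measurable κ) (hp : ∀ a, IsProbabilityMeasure (κ a))
    {g : α × β → Measure γ} (hg : Measurable g) :
    Measurable fun a => (κ a).bind (fun b => g (a, b)) := by
  refine Measure.measurable_of_measurable_coe _ fun s hs => ?_
  have : ∀ a, (κ a).bind (fun b => g (a, b)) s = ∫⁻ b, g (a, b) s ∂(κ a) := fun a => by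
    have hga : Measurable fun b => g (a, b) := hg.comp measurable_prodMk_left
    rw [Measure.bind_apply hs hga.aemeasurable]
  simp_rw [this]
  exact meas_lint hκ hp ((Measure.measurable_coe hs).comp hg)

theorem integral_bind' {κ : α → Measure β} (hκ : Measurable κ)
    (hp : ∀ a, IsProbabilityMeasure (κ a)) (μ : Measure α) [IsProbabilityMeasure μ]
    {f : β → ℝ} (hf : Measurable f) {C : ℝ} (hC : ∀ b, |f b| ≤ C) :
    ∫ b, f b ∂(μ.bind κ) = ∫ a, ∫ b, f b ∂(κ a) ∂μ := by
  let k : Kernel α β := ⟨κ, hκ⟩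
  have : IsMarkovKernel k := ⟨hp⟩
  have e : μ.bind κ = (μ.compProd k).snd := (Measure.snd_compProd μ k).symm
  rw [e, Measure.snd, integral_map measurable_snd.aemeasurable hf.aestronglyMeasurable,
    Measure.integral_compProd]
  · rfl
  · exact Integrable.of_bound (hf.comp measurable_snd).aestronglyMeasurable C
      (Eventually.of_forall fun q => hC _)

end Gen

section Occ
variable {n l : ℕ}
variable {X : Type} [Countable X] [MeasurableSpace X] [DiscreteMeasurableSpace X]
  [TopologicalSpace X] [DiscreteTopology X] [BorelSpace X] [SecondCountableTopology X]
variable {A : Fin n → Type} [∀ i, MeasurableSpace (A i)] [∀ i, TopologicalSpace (A i)]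
  [∀ i, PolishSpace (A i)] [∀ i, BorelSpace (A i)]
variable (G : GameData n l X A)

theorem measurable_p (x : X) : Measurable (G.p x) := by
  refine Measure.measurable_of_measurable_coe _ fun s hs => ?_
  have : ∀ a, G.p x a s = ∑' y, s.indicator 1 y * G.p x a {y} := fun a => by
    rw [← lintegral_indicator_one hs, lintegral_countable']
  simp_rw [this]
  exact Measurable.tsum fun y => (G.hpm x y).const_mul _

theorem measurable_p' : Measurable fun q : X × JA A => G.p q.1 q.2 :=
  measurable_from_prod_countable_right fun x => measurable_p G x

/-- extend a history -/
def hcons {t : ℕ} (h : Hist X (JA A) t) (a : JA A) (y : X) : Hist X (JA A) (t + 1) := (h, a, y)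

theorem measurable_hcons (t : ℕ) :
    Measurable fun q : (Hist X (JA A) t × JA A) × X => hcons q.1.1 q.1.2 q.2 :=
  (measurable_fst.comp measurable_fst).prodMk
    ((measurable_snd.comp measurable_fst).prodMk measurable_snd)

theorem corr_meas (π : CorrStrategy G) (t : ℕ) :
    Measurable fun h => (π.f t h : Measure (JA A)) :=
  Measure.measurable_of_measurable_coe _ (π.meas t)

theorem measurable_stepP (t : ℕ) : Measurable fun q : Hist X (JA A) t × JA A =>
    G.p (lastState X (JA A) t q.1) q.2 :=
  (measurable_p' G).comp (((measurable_lastState X (JA A) t).comp measurable_fst).prodMk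
    measurable_snd)

theorem measurable_step (t : ℕ) : Measurable fun q : Hist X (JA A) t × JA A =>
    (G.p (lastState X (JA A) t q.1) q.2).map (fun y => hcons q.1 q.2 y) :=
  meas_map (measurable_stepP G t) (fun _ => G.hp _ _) (measurable_hcons t)

theorem lintegral_hist_succ (π : CorrStrategy G) (t : ℕ) {g : Hist X (JA A) (t + 1) → ℝ≥0∞}
    (hg : Measurable g) :
    ∫⁻ k, g k ∂(histMeasC G π (t + 1)) =
      ∫⁻ h, ∫⁻ a, ∫⁻ y, g (hcons h a y) ∂(G.p (lastState X (JA A) t h) a)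
        ∂(π.f t h : Measure (JA A)) ∂(histMeasC G π t) := by
  change ∫⁻ k, g k ∂((histMeasC G π t).bind fun h =>
        ((π.f t h : Measure (JA A))).bind fun a =>
          (G.p (lastState X (JA A) t h) a).map fun y => hcons h a y) = _
  rw [Measure.lintegral_bind (meas_bind (corr_meas G π t) (fun _ => inferInstance)
    (measurable_step G t)).aemeasurable hg.aemeasurable]
  congr 1; ext h
  have hm : Measurable fun a => (G.p (lastState X (JA A) t h) a).map fun y => hcons h a y :=
    (measurable_step G t).comp measurable_prodMk_left
  rw [Measure.lintegral_bind hm.aemeasurable hg.aemeasurable]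
  congr 1; ext a
  have hm' : Measurable fun y => hcons h a y :=
    (measurable_hcons t).comp (measurable_prodMk_left (x := (h, a)))
  rw [lintegral_map hg hm']

theorem hist_prob (π : CorrStrategy G) : ∀ t, IsProbabilityMeasure (histMeasC G π t)
  | 0 => G.hη
  | t + 1 => by
    have := hist_prob π t
    have hp := G.hp
    constructor
    rw [← lintegral_one, lintegral_hist_succ G π t measurable_const]
    simp

theorem measurable_last_pair (t : ℕ) : Measurable fun q : Hist X (JA A) t × JA A =>
    (lastState X (JA A) t q.1, q.2) :=
  ((measurable_lastState X (JA A) t).comp measurable_fst).prodMk measurable_snd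

/-- law of the state-action pair at stage t -/
noncomputable def stageM (π : CorrStrategy G) (t : ℕ) : Measure (X × JA A) :=
  (histMeasC G π t).bind fun h =>
        (π.f t h : Measure (JA A)).map fun a => (lastState X (JA A) t h, a)

theorem measurable_stage (π : CorrStrategy G) (t : ℕ) : Measurable fun h =>
    (π.f t h : Measure (JA A)).map fun a => (lastState X (JA A) t h, a) :=
  meas_map (corr_meas G π t) (fun _ => inferInstance) (measurable_last_pair t)

theorem lintegral_stageM (π : CorrStrategy G) (t : ℕ) {g : X × JA A → ℝ≥0∞} (hg : Measurable g) :
    ∫⁻ q, g q ∂(stageM G π t) =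
      ∫⁻ h, ∫⁻ a, g (lastState X (JA A) t h, a) ∂(π.f t h : Measure (JA A))
        ∂(histMeasC G π t) := by
  rw [stageM, Measure.lintegral_bind (measurable_stage G π t).aemeasurable hg.aemeasurable]
  congr 1; ext h
  rw [lintegral_map hg measurable_prodMk_left]

instance (π : CorrStrategy G) (t : ℕ) : IsProbabilityMeasure (stageM G π t) := by
  have := hist_prob G π t
  constructor
  rw [← lintegral_one, lintegral_stageM G π t measurable_const]
  simp

theorem integral_stageM (π : CorrStrategy G) (t : ℕ) {g : X × JA A → ℝ} (hg : Measurable g)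
    {C : ℝ} (hC : ∀ q, |g q| ≤ C) :
    ∫ q, g q ∂(stageM G π t) =
      ∫ h, ∫ a, g (lastState X (JA A) t h, a) ∂(π.f t h : Measure (JA A))
        ∂(histMeasC G π t) := by
  have := hist_prob G π t
  rw [stageM, integral_bind' (measurable_stage G π t) (fun h =>
    Measure.isProbabilityMeasure_map measurable_prodMk_left.aemeasurable) _ hg hC]
  congr 1; ext h
  rw [integral_map measurable_prodMk_left.aemeasurable hg.aestronglyMeasurable]

theorem occ_eq (π : CorrStrategy G) : occ G π =
    ENNReal.ofReal (1 - G.α) • Measure.sum fun t : ℕ => ENNReal.ofReal G.α ^ t • stageM G π t :=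
  rfl

theorem lintegral_occ (π : CorrStrategy G) (g : X × JA A → ℝ≥0∞) :
    ∫⁻ q, g q ∂(occ G π) = ENNReal.ofReal (1 - G.α) *
      ∑' t : ℕ, ENNReal.ofReal G.α ^ t * ∫⁻ q, g q ∂(stageM G π t) := by
  rw [occ_eq, lintegral_smul_measure, lintegral_sum_measure, smul_eq_mul]
  simp_rw [lintegral_smul_measure, smul_eq_mul]

theorem occ_prob (π : CorrStrategy G) : IsProbabilityMeasure (occ G π) := by
  constructor
  rw [← lintegral_one, lintegral_occ]
  simp only [lintegral_one, measure_univ, mul_one]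
  have h0 := G.hα0
  have h1 := G.hα1
  rw [ENNReal.tsum_geometric, ENNReal.ofReal_sub _ h0.le, ENNReal.ofReal_one,
    ENNReal.mul_inv_cancel]
  · exact (tsub_pos_iff_lt.2 (ENNReal.ofReal_lt_one.2 h1)).ne'
  · exact ENNReal.sub_ne_top ENNReal.one_ne_top

theorem integral_occ (π : CorrStrategy G) {g : X × JA A → ℝ} (hg : Measurable g)
    {C : ℝ} (hC : ∀ q, |g q| ≤ C) :
    ∫ q, g q ∂(occ G π) = (1 - G.α) * ∑' t : ℕ, G.α ^ t * ∫ q, g q ∂(stageM G π t) := by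
  have := occ_prob G π
  have h0 := G.hα0
  have h1 := G.hα1
  have hi : Integrable g (occ G π) :=
    Integrable.of_bound hg.aestronglyMeasurable C (Eventually.of_forall hC)
  have hne : ENNReal.ofReal (1 - G.α) ≠ 0 := by simpa using h1
  rw [occ_eq] at hi ⊢
  rw [integrable_smul_measure hne ENNReal.ofReal_ne_top] at hi
  rw [integral_smul_measure, integral_sum_measure hi, ENNReal.toReal_ofReal (by linarith),
    smul_eq_mul]
  simp_rw [integral_smul_measure, smul_eq_mul, ENNReal.toReal_pow, ENNReal.toReal_ofReal h0.le]

theorem stage_zero (π : CorrStrategy G) (y : X) :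
    stageM G π 0 ({y} ×ˢ Set.univ) = G.η {y} := by
  have hm : MeasurableSet (({y} : Set X) ×ˢ (Set.univ : Set (JA A))) :=
    (MeasurableSet.of_discrete).prod MeasurableSet.univ
  rw [← lintegral_indicator_one hm, lintegral_stageM G π 0 (measurable_one.indicator hm),
    ← lintegral_indicator_one (s := ({y} : Set X)) MeasurableSet.of_discrete]
  change ∫⁻ h, _ ∂G.η = _
  congr 1; ext h
  have : ∀ a, (({y} : Set X) ×ˢ (Set.univ : Set (JA A))).indicator (1 : X × JA A → ℝ≥0∞) (h, a)
      = ({y} : Set X).indicator 1 h := by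
    intro a; by_cases hh : h = y <;> simp [hh]
  change ∫⁻ a, (({y} : Set X) ×ˢ (Set.univ : Set (JA A))).indicator (1 : X × JA A → ℝ≥0∞) (h, a)
    ∂(π.f 0 h : Measure (JA A)) = _
  simp_rw [this]
  simp

theorem stage_succ (π : CorrStrategy G) (t : ℕ) (y : X) :
    stageM G π (t + 1) ({y} ×ˢ Set.univ) = ∫⁻ q, G.p q.1 q.2 {y} ∂(stageM G π t) := by
  have hm : MeasurableSet (({y} : Set X) ×ˢ (Set.univ : Set (JA A))) :=
    (MeasurableSet.of_discrete).prod MeasurableSet.univ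
  have hy : MeasurableSet ({y} : Set X) := MeasurableSet.of_discrete
  rw [← lintegral_indicator_one hm, lintegral_stageM G π _ (measurable_one.indicator hm),
    lintegral_stageM G π t (g := fun q => G.p q.1 q.2 {y}) ((Measure.measurable_coe hy).comp (measurable_p' G))]
  have : ∀ h : Hist X (JA A) (t + 1), ∫⁻ a, (({y} : Set X) ×ˢ (Set.univ : Set (JA A))).indicator
      (1 : X × JA A → ℝ≥0∞) (lastState X (JA A) (t + 1) h, a) ∂(π.f (t + 1) h : Measure (JA A))
      = ({y} : Set X).indicator 1 (lastState X (JA A) (t + 1) h) := by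
    intro h
    have : ∀ a, (({y} : Set X) ×ˢ (Set.univ : Set (JA A))).indicator (1 : X × JA A → ℝ≥0∞)
        (lastState X (JA A) (t + 1) h, a)
        = ({y} : Set X).indicator 1 (lastState X (JA A) (t + 1) h) := by
      intro a; by_cases hh : lastState X (JA A) (t + 1) h = y <;> simp [hh]
    simp_rw [this]
    simp
  simp_rw [this]
  rw [lintegral_hist_succ G π t (g := fun h => ({y} : Set X).indicator 1 (lastState X (JA A) (t + 1) h))
    ((measurable_one.indicator hy).comp (measurable_lastState X (JA A) (t + 1)))]
  congr 1; ext h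
  congr 1; ext a
  rw [← lintegral_indicator_one hy]
  rfl

theorem occ_char (π : CorrStrategy G) (y : X) :
    occ G π ({y} ×ˢ Set.univ) = ENNReal.ofReal (1 - G.α) * G.η {y} +
      ENNReal.ofReal G.α * ∫⁻ q, G.p q.1 q.2 {y} ∂(occ G π) := by
  have hm : MeasurableSet (({y} : Set X) ×ˢ (Set.univ : Set (JA A))) :=
    (MeasurableSet.of_discrete).prod MeasurableSet.univ
  rw [← lintegral_indicator_one hm, lintegral_occ, lintegral_occ]
  simp_rw [lintegral_indicator_one hm]
  rw [tsum_eq_zero_add' ENNReal.summable, stage_zero]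
  simp_rw [stage_succ, pow_succ', mul_assoc]
  rw [ENNReal.tsum_mul_left]
  simp only [pow_zero, one_mul]
  ring

theorem corr_supp (π : CorrStrategy G) (t : ℕ) (h : Hist X (JA A) t) :
    (π.f t h : Measure (JA A)) (jointSet G (lastState X (JA A) t h)) = 1 := by
  have := π.supp t h
  rw [← ProbabilityMeasure.ennreal_coeFn_eq_coeFn_toMeasure, this]; rfl

theorem meas_of_slices {B : Type} [MeasurableSpace B] {S : X → Set B}
    (hS : ∀ x, MeasurableSet (S x)) : MeasurableSet {q : X × B | q.2 ∈ S q.1} := by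
  have : {q : X × B | q.2 ∈ S q.1} = ⋃ x : X, ({x} : Set X) ×ˢ S x := by
    ext ⟨x, b⟩; simp
  rw [this]
  exact MeasurableSet.iUnion fun x => (MeasurableSet.of_discrete).prod (hS x)

theorem occ_supp (π : CorrStrategy G) :
    ∀ᵐ q ∂(occ G π), q.2 ∈ jointSet G q.1 := by
  have hm : MeasurableSet {q : X × JA A | q.2 ∈ jointSet G q.1} :=
    meas_of_slices fun x => jointSet_meas G x
  have := occ_prob G π
  rw [ae_iff]
  change occ G π ({q : X × JA A | q.2 ∈ jointSet G q.1}ᶜ) = 0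
  rw [← lintegral_indicator_one hm.compl, lintegral_occ]
  have : ∀ t, ∫⁻ q, ({q : X × JA A | q.2 ∈ jointSet G q.1}ᶜ).indicator (1 : X × JA A → ℝ≥0∞) q
      ∂(stageM G π t) = 0 := by
    intro t
    rw [lintegral_stageM G π t (measurable_one.indicator hm.compl)]
    have : ∀ h, ∫⁻ a, ({q : X × JA A | q.2 ∈ jointSet G q.1}ᶜ).indicator
        (1 : X × JA A → ℝ≥0∞) (lastState X (JA A) t h, a) ∂(π.f t h : Measure (JA A)) = 0 := by
      intro h
      have hae : ∀ᵐ a ∂(π.f t h : Measure (JA A)), a ∈ jointSet G (lastState X (JA A) t h) :=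
        (mem_ae_iff_prob_eq_one (jointSet_meas G _)).2 (corr_supp G π t h)
      rw [← lintegral_zero (μ := (π.f t h : Measure (JA A)))]
      refine lintegral_congr_ae ?_
      filter_upwards [hae] with a ha
      simp [ha]
    simp_rw [this]
    simp
  simp_rw [this]
  simp

/-- the correlated strategy of a multi-strategy -/
noncomputable def toCorr (π : MultiStrategy G) : CorrStrategy G where
  f := fun t h => ProbabilityMeasure.pi fun i => (π i).f t h
  meas := fun t s hs => by
    have : Measurable fun h => (Measure.pi fun i => ((π i).f t h : Measure (A i))) := by
      refine Measurable.measure_of_isPiSystem_of_isProbabilityMeasure generateFrom_pi.symm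
        isPiSystem_pi ?_
      rintro _ ⟨s, hs, rfl⟩
      simp_rw [Measure.pi_pi]
      exact Finset.measurable_prod _ fun i _ => (π i).meas t (s i) (hs i (Set.mem_univ i))
    exact (Measure.measurable_coe hs).comp this
  supp := fun t h => by
    rw [jointSet, ProbabilityMeasure.pi_pi]
    simp [(π _).supp]

theorem toCorr_f (π : MultiStrategy G) (t : ℕ) (h : Hist X (JA A) t) :
    ((toCorr G π).f t h : Measure (JA A)) = jointLaw G π t h := rfl

theorem toCorr_hist (π : MultiStrategy G) : ∀ t,
    histMeasC G (toCorr G π) t = histMeas G G.η π t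
  | 0 => rfl
  | t + 1 => by
    rw [histMeasC, histMeas, toCorr_hist π t]
    rfl

end Occ
end CSGame

namespace CSGame

set_option linter.unusedSectionVars false

section Slice
variable {X : Type} [Countable X] [MeasurableSpace X] [DiscreteMeasurableSpace X]
  [TopologicalSpace X] [DiscreteTopology X] [BorelSpace X] [SecondCountableTopology X]
variable {B : Type} [MeasurableSpace B]

theorem sl_meas (x : X) {s : Set B} (hs : MeasurableSet s) :
    MeasurableSet (({x} : Set X) ×ˢ s) := (MeasurableSet.of_discrete).prod hs

theorem slice_inter {μ : Measure (X × B)} [IsProbabilityMeasure μ] {S : X → Set B}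
    (hS : ∀ x, MeasurableSet (S x)) (hμ : μ {q | q.2 ∈ S q.1} = 1) (x : X) (s : Set B) :
    μ ({x} ×ˢ (s ∩ S x)) = μ ({x} ×ˢ s) := by
  have hae : ∀ᵐ q ∂μ, q ∈ {q : X × B | q.2 ∈ S q.1} :=
    (mem_ae_iff_prob_eq_one (meas_of_slices hS)).2 hμ
  refine measure_congr ?_
  filter_upwards [hae] with q hq
  apply propext
  change (q.1 ∈ ({x} : Set X) ∧ q.2 ∈ s ∩ S x) ↔ (q.1 ∈ ({x} : Set X) ∧ q.2 ∈ s)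
  constructor
  · rintro ⟨h1, h2, -⟩; exact ⟨h1, h2⟩
  · rintro ⟨h1, h2⟩
    have h1' : q.1 = x := h1
    exact ⟨h1, h2, h1' ▸ hq⟩

theorem slice_S {μ : Measure (X × B)} [IsProbabilityMeasure μ] {S : X → Set B}
    (hS : ∀ x, MeasurableSet (S x)) (hμ : μ {q | q.2 ∈ S q.1} = 1) (x : X) :
    μ ({x} ×ˢ S x) = μ ({x} ×ˢ Set.univ) := by
  have := slice_inter hS hμ x Set.univ
  rwa [Set.univ_inter] at this

theorem slice_pv (μ : Measure (X × B)) [IsProbabilityMeasure μ] :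
    IsPV fun x : X => (μ ({x} ×ˢ Set.univ)).toReal := by
  refine isPV_of_tsum (fun x => ENNReal.toReal_nonneg) ?_
  simp_rw [ENNReal.ofReal_toReal (measure_ne_top μ _)]
  have : ∀ x : X, μ ({x} ×ˢ Set.univ) = (μ.map Prod.fst) {x} := fun x => by
    rw [Measure.map_apply measurable_fst MeasurableSet.of_discrete]
    congr 1; ext q; simp
  simp_rw [this]
  have hp : IsProbabilityMeasure (μ.map Prod.fst) :=
    Measure.isProbabilityMeasure_map measurable_fst.aemeasurable
  rw [← measure_univ (μ := μ.map Prod.fst), ← lintegral_one, lintegral_countable']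
  simp

theorem slice_decomp {μ : Measure (X × B)} [IsProbabilityMeasure μ] {S : X → Set B}
    (hS : ∀ x, MeasurableSet (S x)) (hμ : μ {q | q.2 ∈ S q.1} = 1)
    (hpos : ∀ x, 0 < μ ({x} ×ˢ Set.univ)) :
    ∃ γ : X → ProbabilityMeasure B, (∀ x, (γ x : Measure B) (S x) = 1) ∧
      μ = mixM (fun x => (μ ({x} ×ˢ Set.univ)).toReal) γ := by
  have hp : ∀ x : X, IsProbabilityMeasure
      ((ProbabilityTheory.cond μ (({x} : Set X) ×ˢ (Set.univ : Set B))).map Prod.snd) := fun x => by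
    have := cond_isProbabilityMeasure (hpos x).ne'
    exact Measure.isProbabilityMeasure_map measurable_snd.aemeasurable
  have hap : ∀ (x : X) (s : Set B), MeasurableSet s →
      ((ProbabilityTheory.cond μ (({x} : Set X) ×ˢ (Set.univ : Set B))).map Prod.snd) s
        = (μ ({x} ×ˢ Set.univ))⁻¹ * μ ({x} ×ˢ s) := fun x s hs => by
    rw [Measure.map_apply measurable_snd hs, cond_apply (sl_meas x MeasurableSet.univ)]
    congr 2; ext q; simp
  let γ : X → ProbabilityMeasure B := fun x => ⟨_, hp x⟩
  refine ⟨γ, fun x => ?_, ext_slices fun x s hs => ?_⟩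
  · change ((ProbabilityTheory.cond μ (({x} : Set X) ×ˢ (Set.univ : Set B))).map Prod.snd) _ = 1
    rw [hap x _ (hS x), slice_S hS hμ, ENNReal.inv_mul_cancel (hpos x).ne' (measure_ne_top _ _)]
  · rw [mixM_apply _ _ _ hs]
    change _ = _ * ((ProbabilityTheory.cond μ (({x} : Set X) ×ˢ (Set.univ : Set B))).map Prod.snd) s
    rw [hap x s hs, ENNReal.ofReal_toReal (measure_ne_top _ _), ← mul_assoc,
      ENNReal.mul_inv_cancel (hpos x).ne' (measure_ne_top _ _), one_mul]

end Slice

section Rep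
variable {n l : ℕ}
variable {X : Type} [Countable X] [MeasurableSpace X] [DiscreteMeasurableSpace X]
  [TopologicalSpace X] [DiscreteTopology X] [BorelSpace X] [SecondCountableTopology X]
variable {A : Fin n → Type} [∀ i, MeasurableSpace (A i)] [∀ i, TopologicalSpace (A i)]
  [∀ i, PolishSpace (A i)] [∀ i, BorelSpace (A i)]
variable (G : GameData n l X A)

/-- real initial weights -/
noncomputable def eta (x : X) : ℝ := (G.η {x}).toReal

theorem fix_rhs (ψ : StatProfile G) {m : X → ℝ} (hm : IsPV m) (y : X) :
    ENNReal.ofReal ((1 - G.α) * eta G y + G.α * ∑' x, m x * Pm G ψ x y) =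
      ENNReal.ofReal (1 - G.α) * G.η {y} +
        ENNReal.ofReal G.α * ∑' x, ENNReal.ofReal (m x) * ENNReal.ofReal (Pm G ψ x y) := by
  have h0 := G.hα0
  have h1 := G.hα1
  have := G.hη
  have hP : ∀ x, 0 ≤ m x * Pm G ψ x y := fun x => mul_nonneg (hm.nonneg x) (Pm_nonneg G ψ x y)
  have hs : Summable fun x => m x * Pm G ψ x y :=
    hm.summable_mul (C := 1) fun x => by
      rw [abs_of_nonneg (Pm_nonneg G ψ x y)]; exact (Pm_pv G ψ x).le_one y
  have he : 0 ≤ eta G y := ENNReal.toReal_nonneg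
  rw [ENNReal.ofReal_add (mul_nonneg (by linarith) he)
      (mul_nonneg h0.le (tsum_nonneg hP)), ENNReal.ofReal_mul (by linarith),
    ENNReal.ofReal_mul h0.le, eta, ENNReal.ofReal_toReal (measure_ne_top _ _),
    ENNReal.ofReal_tsum_of_nonneg hP hs]
  simp_rw [ENNReal.ofReal_mul (hm.nonneg _)]

theorem isFix_iff (ψ : StatProfile G) {m : X → ℝ} (hm : IsPV m) :
    IsFix G.α (eta G) (Pm G ψ) m ↔ ∀ y, ENNReal.ofReal (m y) =
      ENNReal.ofReal (1 - G.α) * G.η {y} +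
        ENNReal.ofReal G.α * ∑' x, ENNReal.ofReal (m x) * ENNReal.ofReal (Pm G ψ x y) := by
  have h0 := G.hα0
  have h1 := G.hα1
  simp_rw [← fix_rhs G ψ hm]
  constructor
  · intro h y; rw [h.eq y]
  · intro h
    refine ⟨hm, fun y => ?_⟩
    refine (ENNReal.ofReal_eq_ofReal_iff (hm.nonneg y) ?_).1 (h y)
    refine add_nonneg (mul_nonneg (by linarith) ENNReal.toReal_nonneg)
      (mul_nonneg h0.le (tsum_nonneg fun x => mul_nonneg (hm.nonneg x) (Pm_nonneg G ψ x y)))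

theorem stat_stage_slice (ψ : StatProfile G) (t : ℕ) (x : X) {s : Set (JA A)}
    (hs : MeasurableSet s) :
    stageM G (toCorr G (ofStatAll G ψ)) t ({x} ×ˢ s) =
      stageM G (toCorr G (ofStatAll G ψ)) t ({x} ×ˢ Set.univ) * piS G ψ x s := by
  have key : ∀ s : Set (JA A), MeasurableSet s →
      stageM G (toCorr G (ofStatAll G ψ)) t ({x} ×ˢ s) =
      (∫⁻ h, ({x} : Set X).indicator 1 (lastState X (JA A) t h)
        ∂(histMeasC G (toCorr G (ofStatAll G ψ)) t)) * piS G ψ x s := by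
    intro s hs
    have hm := sl_meas x hs
    rw [← lintegral_indicator_one hm, lintegral_stageM G _ t (measurable_one.indicator hm),
      ← lintegral_mul_const (f := fun h => ({x} : Set X).indicator 1 (lastState X (JA A) t h)) _
        ((measurable_one.indicator MeasurableSet.of_discrete).comp
        (measurable_lastState X (JA A) t))]
    congr 1; ext h
    have e : ((toCorr G (ofStatAll G ψ)).f t h : Measure (JA A))
      = piS G ψ (lastState X (JA A) t h) := rfl
    rw [e]
    by_cases hh : lastState X (JA A) t h = x
    · rw [hh]
      have : ∀ a, (({x} : Set X) ×ˢ s).indicator (1 : X × JA A → ℝ≥0∞) (x, a)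
          = s.indicator 1 a := by
        intro a; by_cases ha : a ∈ s <;> simp [ha]
      simp_rw [this]
      rw [lintegral_indicator_one hs]
      simp
    · have : ∀ a, (({x} : Set X) ×ˢ s).indicator (1 : X × JA A → ℝ≥0∞)
          (lastState X (JA A) t h, a) = 0 := by
        intro a; simp [hh]
      simp_rw [this]
      simp [hh]
  rw [key s hs, key _ MeasurableSet.univ, measure_univ, mul_one]

theorem stat_occ_slice (ψ : StatProfile G) (x : X) {s : Set (JA A)}
    (hs : MeasurableSet s) :
    occ G (toCorr G (ofStatAll G ψ)) ({x} ×ˢ s) =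
      occ G (toCorr G (ofStatAll G ψ)) ({x} ×ˢ Set.univ) * piS G ψ x s := by
  have hm := sl_meas x hs
  have hu : MeasurableSet (({x} : Set X) ×ˢ (Set.univ : Set (JA A))) := sl_meas x MeasurableSet.univ
  rw [← lintegral_indicator_one hm, ← lintegral_indicator_one hu, lintegral_occ, lintegral_occ]
  simp_rw [lintegral_indicator_one hm, lintegral_indicator_one hu]
  simp_rw [fun t => stat_stage_slice G ψ t x hs, ← mul_assoc]
  rw [ENNReal.tsum_mul_right, mul_assoc]

theorem measurable_projAct (i : Fin n) : Measurable (projAct (X := X) (A := A) i) :=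
  measurable_fst.prodMk ((measurable_pi_apply i).comp measurable_snd)

/-- product law as probability measures -/
noncomputable def piPM (ψ : StatProfile G) (x : X) : ProbabilityMeasure (JA A) :=
  ⟨piS G ψ x, inferInstance⟩

theorem exists_fix (ψ : StatProfile G) : ∃ m, IsFix G.α (eta G) (Pm G ψ) m ∧
    ∀ i (μ : ProbabilityMeasure (X × A i)), (μ : Measure (X × A i)) = mixM m (ψ i).1 →
      μ ∈ MiSet G i := by
  set π := toCorr G (ofStatAll G ψ) with hπ
  have hprob := occ_prob G π
  set m : X → ℝ := fun x => (occ G π ({x} ×ˢ Set.univ)).toReal with hm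
  have hpv : IsPV m := slice_pv (occ G π)
  have hof : ∀ x, ENNReal.ofReal (m x) = occ G π ({x} ×ˢ Set.univ) := fun x =>
    ENNReal.ofReal_toReal (measure_ne_top _ _)
  have hocc : occ G π = mixM m (piPM G ψ) := by
    refine ext_slices fun x s hs => ?_
    rw [mixM_apply _ _ _ hs, hof, stat_occ_slice G ψ x hs]; rfl
  refine ⟨m, (isFix_iff G ψ hpv).2 fun y => ?_, fun i μ hμ => ?_⟩
  · rw [hof, occ_char, hocc, lintegral_mixM (f := fun q => G.p q.1 q.2 {y}) m _
      ((Measure.measurable_coe MeasurableSet.of_discrete).comp (measurable_p' G))]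
    simp_rw [ofReal_Pm]; rfl
  · refine ⟨⟨occ G π, hprob⟩, ⟨π, rfl⟩, ?_⟩
    rw [hμ]
    change _ = (occ G π).map (projAct i)
    refine ext_slices fun x s hs => ?_
    have hpre : projAct (X := X) (A := A) i ⁻¹' ({x} ×ˢ s) = {x} ×ˢ ((fun a => a i) ⁻¹' s) := by
      ext q; rfl
    rw [Measure.map_apply (measurable_projAct i) (sl_meas x hs), hpre, hocc,
      mixM_apply _ _ _ hs, mixM_apply _ _ _ (measurable_pi_apply i hs)]
    congr 1
    exact ((measurePreserving_eval (fun j => ((ψ j).1 x : Measure (A j))) i).measure_preimage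
      hs.nullMeasurableSet).symm

/-- stationary representation of a measure -/
structure Rp (φ : StatProfile G) (i : Fin n) (μ : ProbabilityMeasure (X × A i))
    (γ : Stat G i) (m : X → ℝ) : Prop where
  fix : IsFix G.α (eta G) (Pm G (updStat G φ i γ)) m
  eq : (μ : Measure (X × A i)) = mixM m γ.1

/-- support and characteristic equation -/
def Chr (φ : StatProfile G) (i : Fin n) (μ : ProbabilityMeasure (X × A i)) : Prop :=
  (μ : Measure (X × A i)) {q : X × A i | q.2 ∈ G.As i q.1} = 1 ∧
  ∀ x : X, (μ : Measure (X × A i)) ({x} ×ˢ G.As i x) =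
    ENNReal.ofReal (1 - G.α) * G.η {x} +
      ENNReal.ofReal G.α *
        ∫⁻ q : X × A i, pbar G φ i x q.1 q.2 ∂(μ : Measure (X × A i))

theorem lintegral_pbar_mix (φ : StatProfile G) (i : Fin n) (γ : Stat G i) (m : X → ℝ) (y : X) :
    ∫⁻ q : X × A i, pbar G φ i y q.1 q.2 ∂(mixM m γ.1) =
      ∑' x, ENNReal.ofReal (m x) * ENNReal.ofReal (Pm G (updStat G φ i γ) x y) := by
  rw [lintegral_mixM _ _ (measurable_pbar G φ i y)]
  simp_rw [lintegral_pbar]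

theorem mixM_supp {i : Fin n} (γ : Stat G i) {m : X → ℝ} (hm : IsPV m) :
    mixM m γ.1 {q : X × A i | q.2 ∈ G.As i q.1} = 1 := by
  have hM : MeasurableSet {q : X × A i | q.2 ∈ G.As i q.1} := meas_of_slices (As_meas G i)
  have := mixM_prob hm γ.1
  rw [← lintegral_indicator_one hM, lintegral_mixM _ _ (measurable_one.indicator hM)]
  have h1 : ∀ x, ∫⁻ b, {q : X × A i | q.2 ∈ G.As i q.1}.indicator (1 : X × A i → ℝ≥0∞) (x, b)
      ∂(γ.1 x : Measure (A i)) = 1 := fun x => by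
    rw [← stat_supp G γ x, ← lintegral_indicator_one (As_meas G i x)]
    rfl
  simp_rw [h1, mul_one]
  rw [← ENNReal.ofReal_tsum_of_nonneg hm.nonneg hm.hasSum.summable, hm.hasSum.tsum_eq]
  simp

theorem Rp.chr {φ : StatProfile G} {i : Fin n} {μ : ProbabilityMeasure (X × A i)}
    {γ : Stat G i} {m : X → ℝ} (h : Rp G φ i μ γ m) : Chr G φ i μ := by
  refine ⟨?_, fun x => ?_⟩
  · rw [h.eq]; exact mixM_supp G γ h.fix.pv
  · rw [h.eq, lintegral_pbar_mix, mixM_apply _ _ _ (As_meas G i x), stat_supp, mul_one]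
    exact (isFix_iff G _ h.fix.pv).1 h.fix x

theorem Chr.rep (hD : AssumptionD G) {φ : StatProfile G} {i : Fin n}
    {μ : ProbabilityMeasure (X × A i)} (h : Chr G φ i μ) : ∃ γ m, Rp G φ i μ γ m := by
  have hsl := slice_S (As_meas G i) h.1
  have hpos : ∀ x, 0 < (μ : Measure (X × A i)) ({x} ×ˢ Set.univ) := fun x => by
    rw [← hsl, h.2 x]
    refine lt_of_lt_of_le ?_ le_self_add
    exact ENNReal.mul_pos (by simpa using G.hα1) (hD x).ne'
  obtain ⟨γ, hγ, he⟩ := slice_decomp (As_meas G i) h.1 hpos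
  have hpv := slice_pv (μ : Measure (X × A i))
  let γ' : Stat G i := ⟨γ, fun x => by
    have := hγ x
    rw [← ProbabilityMeasure.ennreal_coeFn_eq_coeFn_toMeasure] at this
    exact_mod_cast this⟩
  refine ⟨γ', _, (isFix_iff G _ hpv).2 fun y => ?_, he⟩
  rw [ENNReal.ofReal_toReal (measure_ne_top _ _), ← hsl, h.2 y, ← lintegral_pbar_mix]
  congr 3

theorem Rp.int {φ : StatProfile G} {i : Fin n} {μ : ProbabilityMeasure (X × A i)}
    {γ : Stat G i} {m : X → ℝ} (h : Rp G φ i μ γ m) {ℓ : Fin (l + 1)} {C : ℝ}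
    (hC : ∀ x a, |G.c i ℓ x a| ≤ C) :
    ∫ q : X × A i, cbar G φ i ℓ q.1 q.2 ∂(μ : Measure (X × A i)) =
      ∑' x, m x * Cm G i ℓ (updStat G φ i γ) x := by
  rw [h.eq, integral_mixM h.fix.pv γ.1 (measurable_cbar G φ i ℓ)
    (fun q => abs_cbar_le G φ i ℓ hC q.1 q.2)]
  simp_rw [integral_cbar G φ i ℓ hC γ]

theorem updStat_self (φ : StatProfile G) (i : Fin n) (γ : Stat G i) : updStat G φ i γ i = γ := by
  simp [updStat]

theorem Rp.mem {φ : StatProfile G} {i : Fin n} {μ : ProbabilityMeasure (X × A i)}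
    {γ : Stat G i} {m : X → ℝ} (h : Rp G φ i μ γ m) : μ ∈ MiSet G i := by
  obtain ⟨m', h1, h2⟩ := exists_fix G (updStat G φ i γ)
  have := fix_unique G.hα0 G.hα1 (Pm_pv G _) h1 h.fix
  subst this
  refine h2 i μ ?_
  rw [updStat_self, h.eq]

/-- the measure generated by a stationary deviation -/
theorem exists_rep (φ : StatProfile G) (i : Fin n) (γ : Stat G i) :
    ∃ (μ : ProbabilityMeasure (X × A i)) (m : X → ℝ), Rp G φ i μ γ m := by
  obtain ⟨m, h1, -⟩ := exists_fix G (updStat G φ i γ)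
  exact ⟨⟨mixM m γ.1, mixM_prob h1.pv _⟩, m, h1, rfl⟩

theorem feas_iff (φ : StatProfile G) (i : Fin n) (μ : ProbabilityMeasure (X × A i)) :
    COPFeasible G φ i μ ↔ Chr G φ i μ ∧ ∀ ℓ : Fin (l + 1), ℓ ≠ 0 →
      ∫ q : X × A i, cbar G φ i ℓ q.1 q.2 ∂(μ : Measure (X × A i)) ≤ G.κ i ℓ := by
  unfold COPFeasible Chr; tauto

theorem mi_supp {i : Fin n} {μ : ProbabilityMeasure (X × A i)} (h : μ ∈ MiSet G i) :
    (μ : Measure (X × A i)) {q : X × A i | q.2 ∈ G.As i q.1} = 1 := by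
  obtain ⟨ρ, ⟨π, hπ⟩, hμ⟩ := h
  have hM : MeasurableSet {q : X × A i | q.2 ∈ G.As i q.1} := meas_of_slices (As_meas G i)
  rw [← mem_ae_iff_prob_eq_one hM, hμ, hπ, mem_ae_map_iff (measurable_projAct i).aemeasurable hM]
  filter_upwards [occ_supp G π] with q hq
  exact hq i (Set.mem_univ i)

theorem mi_pos (hD : AssumptionD G) {i : Fin n} {μ : ProbabilityMeasure (X × A i)}
    (h : μ ∈ MiSet G i) (x : X) : 0 < (μ : Measure (X × A i)) ({x} ×ˢ Set.univ) := by
  obtain ⟨ρ, ⟨π, hπ⟩, hμ⟩ := h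
  have hpre : projAct (X := X) (A := A) i ⁻¹' ({x} ×ˢ Set.univ) = {x} ×ˢ Set.univ := by
    ext q; simp [projAct]
  rw [hμ, hπ, Measure.map_apply (measurable_projAct i) (sl_meas x MeasurableSet.univ), hpre,
    occ_char]
  refine lt_of_lt_of_le ?_ le_self_add
  exact ENNReal.mul_pos (by simpa using G.hα1) (hD x).ne'

theorem exists_disint (hD : AssumptionD G) {i : Fin n} {μ : ProbabilityMeasure (X × A i)}
    (h : μ ∈ MiSet G i) : ∃ φ : Stat G i, Disint G i μ φ := by
  obtain ⟨γ, hγ, he⟩ := slice_decomp (As_meas G i) (mi_supp G h) (mi_pos G hD h)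
  refine ⟨⟨γ, fun x => ?_⟩, fun x B hB hBs => ?_⟩
  · have := hγ x
    rw [← ProbabilityMeasure.ennreal_coeFn_eq_coeFn_toMeasure] at this
    exact_mod_cast this
  · rw [marg, slice_S (As_meas G i) (mi_supp G h)]
    conv_lhs => rw [he]
    rw [mixM_apply _ _ _ hB, ENNReal.ofReal_toReal (measure_ne_top _ _), mul_comm]
    congr 1
    exact (ProbabilityMeasure.ennreal_coeFn_eq_coeFn_toMeasure _ _).symm

end Rep
end CSGame

namespace CSGame

set_option linter.unusedSectionVars false

section Fin5
variable {n l : ℕ}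
variable {X : Type} [Countable X] [MeasurableSpace X] [DiscreteMeasurableSpace X]
  [TopologicalSpace X] [DiscreteTopology X] [BorelSpace X] [SecondCountableTopology X]
variable {A : Fin n → Type} [∀ i, MeasurableSpace (A i)] [∀ i, TopologicalSpace (A i)]
  [∀ i, PolishSpace (A i)] [∀ i, BorelSpace (A i)]
variable (G : GameData n l X A)

theorem dev_law (φ : StatProfile G) (i : Fin n) (σ : Strategy G i) (t : ℕ)
    (h : Hist X (JA A) t) :
    ((toCorr G (combine G (ofStatAll G φ) i σ)).f t h : Measure (JA A)) =
      Measure.pi (Function.update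
        (fun j => ((φ j).1 (lastState X (JA A) t h) : Measure (A j))) i (σ.f t h : Measure (A i))) := by
  rw [toCorr_f]
  unfold jointLaw combine
  congr 1; ext1 j
  by_cases hj : j = i
  · subst hj; simp
  · simp only [Function.update_of_ne hj]; rfl

theorem map_eval_upd (μ : ∀ j, Measure (A j)) [∀ j, IsProbabilityMeasure (μ j)] (i : Fin n)
    (ν : Measure (A i)) [IsProbabilityMeasure ν] :
    (Measure.pi (Function.update μ i ν)).map (fun a => a i) = ν := by
  have := upd_prob μ i ν
  have h := (measurePreserving_eval (Function.update μ i ν) i).map_eq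
  rw [Function.update_self] at h
  exact h

theorem int_eval_upd (μ : ∀ j, Measure (A j)) [∀ j, IsProbabilityMeasure (μ j)] (i : Fin n)
    (ν : Measure (A i)) [IsProbabilityMeasure ν] {f : A i → ℝ} (hf : Measurable f) :
    ∫ a, f (a i) ∂(Measure.pi (Function.update μ i ν)) = ∫ b, f b ∂ν := by
  conv_rhs => rw [← map_eval_upd μ i ν]
  rw [integral_map (measurable_pi_apply i).aemeasurable hf.aestronglyMeasurable]

theorem lint_eval_upd (μ : ∀ j, Measure (A j)) [∀ j, IsProbabilityMeasure (μ j)] (i : Fin n)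
    (ν : Measure (A i)) [IsProbabilityMeasure ν] {f : A i → ℝ≥0∞} (hf : Measurable f) :
    ∫⁻ a, f (a i) ∂(Measure.pi (Function.update μ i ν)) = ∫⁻ b, f b ∂ν := by
  conv_rhs => rw [← map_eval_upd μ i ν]
  rw [lintegral_map hf (measurable_pi_apply i)]

theorem meas_sect {B γ : Type} [MeasurableSpace B] [MeasurableSpace γ] (F : X → B → γ)
    (hF : Measurable fun q : X × B => F q.1 q.2) (x : X) : Measurable (F x) :=
  hF.comp (measurable_prodMk_left (x := x))

theorem meas_proj {γ : Type} [MeasurableSpace γ] (i : Fin n) (F : X → A i → γ)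
    (hF : Measurable fun q : X × A i => F q.1 q.2) :
    Measurable fun q : X × JA A => F q.1 (q.2 i) :=
  hF.comp (measurable_projAct i)

theorem inner_int (φ : StatProfile G) (i : Fin n) (x : X) (ν : Measure (A i))
    [IsProbabilityMeasure ν] {ℓ : Fin (l + 1)} {C : ℝ} (hC : ∀ x a, |G.c i ℓ x a| ≤ C) :
    ∫ a, cbar G φ i ℓ x (a i)
      ∂(Measure.pi (Function.update (fun j => ((φ j).1 x : Measure (A j))) i ν)) =
    ∫ a, G.c i ℓ x a
      ∂(Measure.pi (Function.update (fun j => ((φ j).1 x : Measure (A j))) i ν)) := by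
  have hcx := meas_sect (cbar G φ i ℓ) (measurable_cbar G φ i ℓ) x
  rw [int_eval_upd _ i ν hcx, integral_pi_update _ _ _ (G.hc i ℓ x) (hC x)]
  simp_rw [cbar_eq]
  rfl

theorem inner_lint (φ : StatProfile G) (i : Fin n) (x y : X) (ν : Measure (A i))
    [IsProbabilityMeasure ν] :
    ∫⁻ a, pbar G φ i y x (a i)
      ∂(Measure.pi (Function.update (fun j => ((φ j).1 x : Measure (A j))) i ν)) =
    ∫⁻ a, G.p x a {y}
      ∂(Measure.pi (Function.update (fun j => ((φ j).1 x : Measure (A j))) i ν)) := by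
  have hcx := meas_sect (pbar G φ i y) (measurable_pbar G φ i y) x
  rw [lint_eval_upd _ i ν hcx, lintegral_pi_update _ _ _ (G.hpm x y)]
  simp_rw [pbar_eq]
  rfl

theorem dev_int_gen (φ : StatProfile G) (i : Fin n) (σ : Strategy G i) {C : ℝ}
    (f : X → JA A → ℝ) (F : X → A i → ℝ) (hF : Measurable fun q : X × A i => F q.1 q.2)
    (hFb : ∀ x b, |F x b| ≤ C)
    (hE : ∀ x (ν : Measure (A i)) [IsProbabilityMeasure ν], ∫ a, F x (a i)
      ∂(Measure.pi (Function.update (fun j => ((φ j).1 x : Measure (A j))) i ν)) =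
      ∫ a, f x a ∂(Measure.pi (Function.update (fun j => ((φ j).1 x : Measure (A j))) i ν)))
    (π : MultiStrategy G) (hπ : π = combine G (ofStatAll G φ) i σ) :
    ∫ q, F q.1 q.2 ∂((occ G (toCorr G π)).map (projAct i)) = Jfun G G.η f π := by
  have hm := meas_proj i F hF
  have hbd : ∀ q : X × JA A, |F q.1 (q.2 i)| ≤ C := fun q => hFb _ _
  have h1 : ∫ q, F q.1 q.2 ∂((occ G (toCorr G π)).map (projAct i)) =
      ∫ q, F q.1 (q.2 i) ∂(occ G (toCorr G π)) :=
    integral_map (measurable_projAct i).aemeasurable hF.aestronglyMeasurable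
  rw [h1, integral_occ G _ hm hbd, Jfun]
  congr 1
  refine tsum_congr fun t => ?_
  congr 1
  rw [integral_stageM G _ t hm hbd, stageExp, toCorr_hist]
  refine integral_congr_ae (Filter.Eventually.of_forall fun h => ?_)
  have h2 := dev_law G φ i σ t h
  rw [← hπ] at h2
  simp only [← toCorr_f, h2]
  exact hE _ _

theorem dev_lint_gen (φ : StatProfile G) (i : Fin n) (σ : Strategy G i)
    (f : X → JA A → ℝ≥0∞) (hf : Measurable fun q : X × JA A => f q.1 q.2)
    (F : X → A i → ℝ≥0∞) (hF : Measurable fun q : X × A i => F q.1 q.2)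
    (hE : ∀ x (ν : Measure (A i)) [IsProbabilityMeasure ν], ∫⁻ a, F x (a i)
      ∂(Measure.pi (Function.update (fun j => ((φ j).1 x : Measure (A j))) i ν)) =
      ∫⁻ a, f x a ∂(Measure.pi (Function.update (fun j => ((φ j).1 x : Measure (A j))) i ν)))
    (π : MultiStrategy G) (hπ : π = combine G (ofStatAll G φ) i σ) :
    ∫⁻ q, F q.1 q.2 ∂((occ G (toCorr G π)).map (projAct i)) =
      ∫⁻ q, f q.1 q.2 ∂(occ G (toCorr G π)) := by
  have hm := meas_proj i F hF
  have h1 : ∫⁻ q, F q.1 q.2 ∂((occ G (toCorr G π)).map (projAct i)) =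
      ∫⁻ q, F q.1 (q.2 i) ∂(occ G (toCorr G π)) :=
    lintegral_map hF (measurable_projAct i)
  rw [h1, lintegral_occ, lintegral_occ]
  congr 1
  refine tsum_congr fun t => ?_
  congr 1
  rw [lintegral_stageM G _ t hm, lintegral_stageM G _ t hf]
  refine lintegral_congr fun h => ?_
  have h2 := dev_law G φ i σ t h
  rw [← hπ] at h2
  simp only [h2]
  exact hE _ _

theorem dev_int (φ : StatProfile G) (i : Fin n) (σ : Strategy G i) {ℓ : Fin (l + 1)} {C : ℝ}
    (hC : ∀ x a, |G.c i ℓ x a| ≤ C) (π : MultiStrategy G)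
    (hπ : π = combine G (ofStatAll G φ) i σ) :
    ∫ q, cbar G φ i ℓ q.1 q.2 ∂((occ G (toCorr G π)).map (projAct i)) = J G i ℓ π :=
  dev_int_gen G φ i σ (G.c i ℓ) (cbar G φ i ℓ) (measurable_cbar G φ i ℓ)
    (fun x b => abs_cbar_le G φ i ℓ hC x b) (fun x ν _ => inner_int G φ i x ν hC) π hπ

theorem dev_lint (φ : StatProfile G) (i : Fin n) (σ : Strategy G i) (y : X) (π : MultiStrategy G)
    (hπ : π = combine G (ofStatAll G φ) i σ) :
    ∫⁻ q, pbar G φ i y q.1 q.2 ∂((occ G (toCorr G π)).map (projAct i)) =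
      ∫⁻ q, G.p q.1 q.2 {y} ∂(occ G (toCorr G π)) := by
  have hm2 : Measurable fun q : X × JA A => G.p q.1 q.2 {y} :=
    (Measure.measurable_coe MeasurableSet.of_discrete).comp (measurable_p' G)
  exact dev_lint_gen G φ i σ (fun x a => G.p x a {y}) hm2 (pbar G φ i y) (measurable_pbar G φ i y)
    (fun x ν _ => inner_lint G φ i x y ν) π hπ

theorem slater (hC : AssumptionC G) (hb : BoundedCosts G) (φ : StatProfile G) (i : Fin n) :
    ∃ ν : ProbabilityMeasure (X × A i), Chr G φ i ν ∧ ∀ ℓ : Fin (l + 1), ℓ ≠ 0 →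
      ∫ q : X × A i, cbar G φ i ℓ q.1 q.2 ∂(ν : Measure (X × A i)) < G.κ i ℓ := by
  obtain ⟨σ, hσ⟩ := hC φ i
  set π := toCorr G (combine G (ofStatAll G φ) i σ) with hπ
  have hp := occ_prob G π
  let ν : ProbabilityMeasure (X × A i) := ⟨(occ G π).map (projAct i),
    Measure.isProbabilityMeasure_map (measurable_projAct i).aemeasurable⟩
  have hmi : ν ∈ MiSet G i := ⟨⟨occ G π, hp⟩, ⟨π, rfl⟩, rfl⟩
  refine ⟨ν, ⟨mi_supp G hmi, fun x => ?_⟩, fun ℓ hℓ => ?_⟩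
  · rw [slice_S (As_meas G i) (mi_supp G hmi)]
    have e : ∫⁻ q, pbar G φ i x q.1 q.2 ∂(ν : Measure (X × A i)) = _ := dev_lint G φ i σ x _ rfl
    rw [e]
    have hpre : projAct (X := X) (A := A) i ⁻¹' ({x} ×ˢ Set.univ) = {x} ×ˢ Set.univ := by
      ext q; simp [projAct]
    change (occ G π).map (projAct i) _ = _
    rw [Measure.map_apply (measurable_projAct i) (sl_meas x MeasurableSet.univ), hpre,
      occ_char]
  · obtain ⟨C, hC'⟩ := hb i ℓ
    have e : ∫ q, cbar G φ i ℓ q.1 q.2 ∂(ν : Measure (X × A i)) = _ := dev_int G φ i σ hC' _ rfl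
    rw [e]
    exact hσ ℓ hℓ

/-- convex combination of probability measures -/
theorem exists_cvx {B : Type} [MeasurableSpace B] (μ₁ μ₂ : ProbabilityMeasure B) {θ : ℝ}
    (h0 : 0 ≤ θ) (h1 : θ ≤ 1) : ∃ μ : ProbabilityMeasure B, (μ : Measure B) =
      ENNReal.ofReal θ • (μ₁ : Measure B) + ENNReal.ofReal (1 - θ) • (μ₂ : Measure B) := by
  refine ⟨⟨_, ⟨?_⟩⟩, rfl⟩
  simp only [Measure.coe_add, Pi.add_apply, Measure.smul_apply, measure_univ, smul_eq_mul, mul_one]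
  rw [← ENNReal.ofReal_add h0 (by linarith)]
  simp

theorem cvx_aux {θ : ℝ} (h0 : 0 ≤ θ) (h1 : θ ≤ 1) (a b c d : ℝ≥0∞) :
    ENNReal.ofReal θ * (a + b * c) + ENNReal.ofReal (1 - θ) * (a + b * d) =
      a + b * (ENNReal.ofReal θ * c + ENNReal.ofReal (1 - θ) * d) := by
  have : ENNReal.ofReal θ + ENNReal.ofReal (1 - θ) = 1 := by
    rw [← ENNReal.ofReal_add h0 (by linarith)]; simp
  calc _ = (ENNReal.ofReal θ + ENNReal.ofReal (1 - θ)) * a +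
        b * (ENNReal.ofReal θ * c + ENNReal.ofReal (1 - θ) * d) := by ring
    _ = _ := by rw [this, one_mul]

theorem chr_cvx {φ : StatProfile G} {i : Fin n} {μ₁ μ₂ μ : ProbabilityMeasure (X × A i)} {θ : ℝ}
    (h0 : 0 ≤ θ) (h1 : θ ≤ 1) (he : (μ : Measure (X × A i)) =
      ENNReal.ofReal θ • (μ₁ : Measure (X × A i)) + ENNReal.ofReal (1 - θ) • (μ₂ : Measure (X × A i)))
    (c1 : Chr G φ i μ₁) (c2 : Chr G φ i μ₂) : Chr G φ i μ := by
  constructor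
  · rw [he]
    simp only [Measure.coe_add, Pi.add_apply, Measure.smul_apply, c1.1, c2.1, smul_eq_mul, mul_one]
    rw [← ENNReal.ofReal_add h0 (by linarith)]; simp
  · intro x
    rw [he, lintegral_add_measure, lintegral_smul_measure, lintegral_smul_measure]
    simp only [Measure.coe_add, Pi.add_apply, Measure.smul_apply, c1.2 x, c2.2 x, smul_eq_mul]
    exact cvx_aux h0 h1 _ _ _ _

theorem int_cvx {φ : StatProfile G} {i : Fin n} {μ₁ μ₂ μ : ProbabilityMeasure (X × A i)} {θ : ℝ}
    (h0 : 0 ≤ θ) (h1 : θ ≤ 1) (he : (μ : Measure (X × A i)) =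
      ENNReal.ofReal θ • (μ₁ : Measure (X × A i)) + ENNReal.ofReal (1 - θ) • (μ₂ : Measure (X × A i)))
    (hb : BoundedCosts G) (ℓ : Fin (l + 1)) :
    ∫ q : X × A i, cbar G φ i ℓ q.1 q.2 ∂(μ : Measure (X × A i)) =
      θ * ∫ q : X × A i, cbar G φ i ℓ q.1 q.2 ∂(μ₁ : Measure (X × A i)) +
      (1 - θ) * ∫ q : X × A i, cbar G φ i ℓ q.1 q.2 ∂(μ₂ : Measure (X × A i)) := by
  obtain ⟨C, hC⟩ := hb i ℓ
  have hi : ∀ μ : ProbabilityMeasure (X × A i),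
      Integrable (fun q : X × A i => cbar G φ i ℓ q.1 q.2) (μ : Measure (X × A i)) := fun μ =>
    Integrable.of_bound (measurable_cbar G φ i ℓ).aestronglyMeasurable C
      (Eventually.of_forall fun q => abs_cbar_le G φ i ℓ hC q.1 q.2)
  rw [he, integral_add_measure ((hi μ₁).smul_measure ENNReal.ofReal_ne_top)
    ((hi μ₂).smul_measure ENNReal.ofReal_ne_top), integral_smul_measure, integral_smul_measure,
    ENNReal.toReal_ofReal h0, ENNReal.toReal_ofReal (by linarith), smul_eq_mul, smul_eq_mul]

theorem stat_lim {T : Type} (𝒰 : Ultrafilter T) {i : Fin n} (γ' : T → Stat G i) :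
    ∃ γ : Stat G i, ∀ x, Tendsto (fun t => (γ' t).1 x) 𝒰 (𝓝 (γ.1 x)) := by
  have key : ∀ x, ∃ g : ProbabilityMeasure (A i), g (G.As i x) = 1 ∧
      Tendsto (fun t => (γ' t).1 x) 𝒰 (𝓝 g) := by
    intro x
    have hK := isCompact_setOfPred_probabilityMeasure_mass_eq_compl_isCompact_le
      (E := A i) (u := fun _ => 0) (K := fun _ => G.As i x) tendsto_const_nhds
      (fun _ => G.hAs_cpt i x) (Or.inr monotone_const)
    have hc : ∀ g : ProbabilityMeasure (A i), g (G.As i x) = 1 ↔ g (G.As i x)ᶜ = 0 := by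
      intro g
      have h1 : g (G.As i x) = 1 ↔ (g : Measure (A i)) (G.As i x) = 1 := by
        rw [← ProbabilityMeasure.ennreal_coeFn_eq_coeFn_toMeasure]; norm_cast
      have h2 : g (G.As i x)ᶜ = 0 ↔ (g : Measure (A i)) (G.As i x)ᶜ = 0 := by
        rw [← ProbabilityMeasure.ennreal_coeFn_eq_coeFn_toMeasure]; norm_cast
      rw [h1, h2, prob_compl_eq_zero_iff (As_meas G i x)]
    obtain ⟨g, hg, hlim⟩ := hK.ultrafilter_le_nhds' (𝒰.map fun t => (γ' t).1 x)
      (Filter.univ_mem' (f := (𝒰 : Filter T)) fun t => by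
        intro k
        exact ((hc _).1 ((γ' t).2 x)).le)
    exact ⟨g, (hc g).2 (le_antisymm (hg 0) bot_le), hlim⟩
  choose g hg hlim using key
  exact ⟨⟨g, hg⟩, hlim⟩

theorem upd_tendsto {T : Type} {F : Filter T} {φ' : T → StatProfile G} {φ : StatProfile G}
    {i : Fin n} {γ' : T → Stat G i} {γ : Stat G i}
    (hφ : ∀ j x, Tendsto (fun t => (φ' t j).1 x) F (𝓝 ((φ j).1 x)))
    (hγ : ∀ x, Tendsto (fun t => (γ' t).1 x) F (𝓝 (γ.1 x))) (j : Fin n) (x : X) :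
    Tendsto (fun t => (updStat G (φ' t) i (γ' t) j).1 x) F (𝓝 ((updStat G φ i γ j).1 x)) := by
  unfold updStat
  by_cases h : j = i
  · subst h; simpa using hγ x
  · simpa [Function.update_of_ne h] using hφ j x

theorem rep_tendsto (hA : AssumptionA G) (hb : BoundedCosts G) {T : Type} {F : Filter T}
    {φ' : T → StatProfile G} {φ : StatProfile G}
    {i : Fin n} {γ' : T → Stat G i} {γ : Stat G i}
    (hφ : ∀ j x, Tendsto (fun t => (φ' t j).1 x) F (𝓝 ((φ j).1 x)))
    (hγ : ∀ x, Tendsto (fun t => (γ' t).1 x) F (𝓝 (γ.1 x)))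
    {μ' : T → ProbabilityMeasure (X × A i)} {μ : ProbabilityMeasure (X × A i)}
    {m' : T → X → ℝ} {m : X → ℝ} (h' : ∀ᶠ t in F, Rp G (φ' t) i (μ' t) (γ' t) (m' t))
    (h : Rp G φ i μ γ m) :
    Tendsto μ' F (𝓝 μ) ∧ ∀ ℓ, Tendsto
      (fun t => ∫ q : X × A i, cbar G (φ' t) i ℓ q.1 q.2 ∂(μ' t : Measure (X × A i))) F
      (𝓝 (∫ q : X × A i, cbar G φ i ℓ q.1 q.2 ∂(μ : Measure (X × A i)))) := by
  have hu := upd_tendsto G hφ hγ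
  have hpv : ∀ᶠ t in F, IsPV (m' t) := h'.mono fun t ht => ht.fix.pv
  have hfix := fix_tendsto G.hα0 G.hα1 (Pm_pv G _) (fun t => Pm_pv G (updStat G (φ' t) i (γ' t)))
    h.fix (h'.mono fun t ht => ht.fix) (tendsto_Pm G hA hu)
  constructor
  · rw [ProbabilityMeasure.tendsto_iff_forall_integral_tendsto]
    intro f
    have hfb : ∀ q, |f q| ≤ ‖f‖ := f.norm_coe_le_norm
    have hfm : Measurable f := f.continuous.measurable
    have hlim := tendsto_tsum_pv (C := ‖f‖) hpv h.fix.pv hfix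
      (g' := fun t x => ∫ b, f (x, b) ∂((γ' t).1 x : Measure (A i)))
      (g := fun x => ∫ b, f (x, b) ∂(γ.1 x : Measure (A i)))
      (fun x => by
        let fx : BoundedContinuousFunction (A i) ℝ :=
          f.compContinuous ⟨fun b => (x, b), by fun_prop⟩
        exact (ProbabilityMeasure.tendsto_iff_forall_integral_tendsto.1 (hγ x)) fx)
      (fun t x => abs_integral_le _ fun b => hfb (x, b))
    rw [h.eq, integral_mixM h.fix.pv _ hfm hfb]
    refine hlim.congr' ?_
    filter_upwards [h'] with t ht
    rw [ht.eq, integral_mixM ht.fix.pv _ hfm hfb]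
  · intro ℓ
    obtain ⟨C, hC⟩ := hb i ℓ
    rw [h.int G hC]
    refine (tendsto_tsum_pv (C := C) hpv h.fix.pv hfix (tendsto_Cm G hA hC hu)
      (fun t x => abs_integral_le _ (hC x))).congr' ?_
    filter_upwards [h'] with t ht
    rw [ht.int G hC]

theorem key1 (hA : AssumptionA G) (hb : BoundedCosts G) (hD : AssumptionD G) {T : Type}
    (𝒰 : Ultrafilter T) {φ' : T → StatProfile G} {φ : StatProfile G}
    (hφ : ∀ j x, Tendsto (fun t => (φ' t j).1 x) 𝒰 (𝓝 ((φ j).1 x))) {i : Fin n}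
    {μ' : T → ProbabilityMeasure (X × A i)} (h : ∀ᶠ t in 𝒰, COPFeasible G (φ' t) i (μ' t)) :
    ∃ μ, COPFeasible G φ i μ ∧ Tendsto μ' 𝒰 (𝓝 μ) ∧
      Tendsto (fun t => COPObj G (φ' t) i (μ' t)) 𝒰 (𝓝 (COPObj G φ i μ)) := by
  have hr : ∀ᶠ t in 𝒰, ∃ r : Stat G i × (X → ℝ), Rp G (φ' t) i (μ' t) r.1 r.2 := by
    filter_upwards [h] with t ht
    obtain ⟨γ, m, hh⟩ := ((feas_iff G _ _ _).1 ht).1.rep G hD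
    exact ⟨(γ, m), hh⟩
  obtain ⟨r, hr⟩ := hr.choice
  obtain ⟨γ, hγ⟩ := stat_lim G 𝒰 fun t => (r t).1
  obtain ⟨μ, m, hμ⟩ := exists_rep G φ i γ
  obtain ⟨h1, h2⟩ := rep_tendsto G hA hb hφ hγ hr hμ
  refine ⟨μ, (feas_iff G _ _ _).2 ⟨hμ.chr, fun ℓ hℓ => ?_⟩, h1, h2 0⟩
  refine le_of_tendsto (h2 ℓ) ?_
  filter_upwards [h] with t ht
  exact ht.2.1 ℓ hℓ

theorem le_of_mix {a b c : ℝ} (h : ∀ θ : ℝ, 0 < θ → θ ≤ 1 → a ≤ θ * b + (1 - θ) * c) : a ≤ c := by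
  by_contra! hac
  have h1 := h 1 one_pos le_rfl
  have hbc : 0 < b - c := by linarith
  have hθ : 0 < (a - c) / (2 * (b - c)) := by apply div_pos <;> linarith
  have hθ1 : (a - c) / (2 * (b - c)) ≤ 1 := by rw [div_le_one (by linarith)]; linarith
  have h2 := h _ hθ hθ1
  have h3 : (a - c) / (2 * (b - c)) * (b - c) = (a - c) / 2 := by field_simp
  nlinarith

theorem key2 (hA : AssumptionA G) (hC : AssumptionC G) (hb : BoundedCosts G) (hD : AssumptionD G)
    {T : Type}
    (𝒰 : Ultrafilter T) {φ' : T → StatProfile G} {φ : StatProfile G}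
    (hφ : ∀ j x, Tendsto (fun t => (φ' t j).1 x) 𝒰 (𝓝 ((φ j).1 x))) {i : Fin n}
    {μ' : T → ProbabilityMeasure (X × A i)} (h : ∀ᶠ t in 𝒰, μ' t ∈ COPSol G (φ' t) i) :
    ∃ μ ∈ COPSol G φ i, Tendsto μ' 𝒰 (𝓝 μ) := by
  obtain ⟨μ, hμ, hlim, hobj⟩ := key1 G hA hb hD 𝒰 hφ (h.mono fun t ht => ht.1)
  refine ⟨μ, ⟨hμ, fun ν hν => ?_⟩, hlim⟩
  have strict : ∀ ν : ProbabilityMeasure (X × A i), Chr G φ i ν → (∀ ℓ : Fin (l + 1), ℓ ≠ 0 →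
      ∫ q : X × A i, cbar G φ i ℓ q.1 q.2 ∂(ν : Measure (X × A i)) < G.κ i ℓ) →
      COPObj G φ i μ ≤ COPObj G φ i ν := by
    intro ν hν hs
    obtain ⟨γ, m, hr⟩ := hν.rep G hD
    choose ν' m' hr' using fun t => exists_rep G (φ' t) i γ
    obtain ⟨-, h2⟩ := rep_tendsto G hA hb hφ (γ' := fun _ => γ) (γ := γ)
      (fun x => tendsto_const_nhds) (Eventually.of_forall hr') hr
    refine le_of_tendsto_of_tendsto hobj (h2 0) ?_
    have hev : ∀ᶠ t in 𝒰, ∀ ℓ : Fin (l + 1), ℓ ≠ 0 →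
        ∫ q : X × A i, cbar G (φ' t) i ℓ q.1 q.2 ∂(ν' t : Measure (X × A i)) < G.κ i ℓ := by
      rw [eventually_all]
      intro ℓ
      by_cases hℓ : ℓ = 0
      · exact Eventually.of_forall fun t h => absurd hℓ h
      · exact ((h2 ℓ).eventually_lt_const (hs ℓ hℓ)).mono fun t ht _ => ht
    filter_upwards [h, hev] with t ht hvt
    exact ht.2 (ν' t) ((feas_iff G _ _ _).2 ⟨(hr' t).chr, fun ℓ hℓ => (hvt ℓ hℓ).le⟩)
  obtain ⟨ν0, hc0, hs0⟩ := slater G hC hb φ i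
  refine le_of_mix (b := COPObj G φ i ν0) fun θ h0 h1 => ?_
  obtain ⟨νθ, he⟩ := exists_cvx ν0 ν h0.le h1
  rw [feas_iff] at hν
  have hInt := fun ℓ => int_cvx G (φ := φ) h0.le h1 he hb ℓ
  refine (strict νθ (chr_cvx G h0.le h1 he hc0 hν.1) fun ℓ hℓ => ?_).trans (hInt 0).le
  rw [hInt ℓ]
  have := hs0 ℓ hℓ
  have := hν.2 ℓ hℓ
  nlinarith

theorem sol_nonempty (hA : AssumptionA G) (hC : AssumptionC G) (hb : BoundedCosts G)
    (hD : AssumptionD G) (φ : StatProfile G) (i : Fin n) : (COPSol G φ i).Nonempty := by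
  obtain ⟨ν0, hc0, hs0⟩ := slater G hC hb φ i
  have hf0 : COPFeasible G φ i ν0 := (feas_iff G _ _ _).2 ⟨hc0, fun ℓ hℓ => (hs0 ℓ hℓ).le⟩
  obtain ⟨C, hC0⟩ := hb i 0
  set V : Set ℝ := COPObj G φ i '' {ν | COPFeasible G φ i ν} with hV
  have hne : V.Nonempty := ⟨_, ν0, hf0, rfl⟩
  have hbd : BddBelow V := by
    refine ⟨-C, ?_⟩
    rintro _ ⟨ν, -, rfl⟩
    exact (abs_le.1 (abs_integral_le _ fun q : X × A i => abs_cbar_le G φ i 0 hC0 q.1 q.2)).1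
  obtain ⟨u, -, hu, huV⟩ := exists_seq_tendsto_sInf hne hbd
  choose μ' hμ' hobj' using huV
  obtain ⟨μ, hμ, -, hobj⟩ := key1 G hA hb hD (hyperfilter ℕ) (φ' := fun _ => φ) (φ := φ)
    (fun j x => tendsto_const_nhds) (μ' := μ') (Eventually.of_forall hμ')
  simp_rw [hobj'] at hobj
  have hu' : Tendsto u (hyperfilter ℕ) (𝓝 (sInf V)) := by
    refine hu.mono_left ?_
    rw [← Nat.cofinite_eq_atTop]; exact hyperfilter_le_cofinite
  have e := tendsto_nhds_unique hobj hu'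
  refine ⟨μ, hμ, fun ν hν => ?_⟩
  rw [e]
  exact csInf_le hbd ⟨ν, hν, rfl⟩

theorem sol_compact (hA : AssumptionA G) (hC : AssumptionC G) (hb : BoundedCosts G)
    (hD : AssumptionD G) (φ : StatProfile G) (i : Fin n) : IsCompact (COPSol G φ i) := by
  rw [isCompact_iff_ultrafilter_le_nhds']
  intro 𝒰 h𝒰
  obtain ⟨μ, hμ, hlim⟩ := key2 G hA hC hb hD 𝒰 (φ' := fun _ => φ) (φ := φ)
    (fun j x => tendsto_const_nhds) (μ' := fun μ => μ) h𝒰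
  exact ⟨μ, hμ, hlim⟩

theorem sol_sub (hD : AssumptionD G) (φ : StatProfile G) (i : Fin n) :
    COPSol G φ i ⊆ MiSet G i := by
  intro μ hμ
  obtain ⟨γ, m, hr⟩ := ((feas_iff G _ _ _).1 hμ.1).1.rep G hD
  exact hr.mem

theorem sol_convex (hb : BoundedCosts G) (φ : StatProfile G) (i : Fin n)
    (μ₁ : ProbabilityMeasure (X × A i)) (hμ₁ : μ₁ ∈ COPSol G φ i)
    (μ₂ : ProbabilityMeasure (X × A i)) (hμ₂ : μ₂ ∈ COPSol G φ i)
    (θ : ℝ) (h0 : 0 ≤ θ) (h1 : θ ≤ 1) :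
    ∃ μ ∈ COPSol G φ i, (μ : Measure (X × A i)) =
      ENNReal.ofReal θ • (μ₁ : Measure (X × A i)) +
        ENNReal.ofReal (1 - θ) • (μ₂ : Measure (X × A i)) := by
  obtain ⟨μ, he⟩ := exists_cvx μ₁ μ₂ h0 h1
  have hInt := fun ℓ => int_cvx G (φ := φ) h0 h1 he hb ℓ
  have f1 := (feas_iff G _ _ _).1 hμ₁.1
  have f2 := (feas_iff G _ _ _).1 hμ₂.1
  refine ⟨μ, ⟨(feas_iff G _ _ _).2 ⟨chr_cvx G h0 h1 he f1.1 f2.1, fun ℓ hℓ => ?_⟩,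
    fun ν hν => ?_⟩, he⟩
  · rw [hInt ℓ]
    have := f1.2 ℓ hℓ
    have := f2.2 ℓ hℓ
    nlinarith
  · have a1 := hμ₁.2 ν hν
    have a2 := hμ₂.2 ν hν
    have a3 : COPObj G φ i μ = θ * COPObj G φ i μ₁ + (1 - θ) * COPObj G φ i μ₂ := hInt 0
    rw [a3]
    nlinarith

theorem disint_mix {i : Fin n} {μ : ProbabilityMeasure (X × A i)} (h : μ ∈ MiSet G i)
    {φ : Stat G i} (hφ : Disint G i μ φ) : (μ : Measure (X × A i)) =
      mixM (fun x => ((μ : Measure (X × A i)) ({x} ×ˢ Set.univ)).toReal) φ.1 := by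
  have hs := mi_supp G h
  refine ext_slices fun x s hms => ?_
  rw [mixM_apply _ _ _ hms, ENNReal.ofReal_toReal (measure_ne_top _ _),
    ← slice_inter (As_meas G i) hs x s,
    hφ x _ (hms.inter (As_meas G i x)) Set.inter_subset_right, marg,
    slice_S (As_meas G i) hs, mul_comm, ProbabilityMeasure.ennreal_coeFn_eq_coeFn_toMeasure]
  congr 1
  have hae : ∀ᵐ a ∂(φ.1 x : Measure (A i)), a ∈ G.As i x :=
    (mem_ae_iff_prob_eq_one (As_meas G i x)).2 (stat_supp G φ x)
  refine measure_congr ?_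
  filter_upwards [hae] with a ha
  apply propext
  exact ⟨fun h => h.1, fun h => ⟨h, ha⟩⟩

/-- test function supported on one slice -/
noncomputable def tf {i : Fin n} (x : X) (f : BoundedContinuousFunction (A i) ℝ) :
    BoundedContinuousFunction (X × A i) ℝ :=
  BoundedContinuousFunction.ofNormedAddCommGroup
    (fun q => (({x} : Set X).indicator (fun _ => (1 : ℝ)) q.1) * f q.2)
    (((continuous_of_discreteTopology
      (f := ({x} : Set X).indicator (fun _ => (1 : ℝ)))).comp continuous_fst).mul
      (f.continuous.comp continuous_snd)) ‖f‖ (fun q => by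
        rw [norm_mul]
        have h1 : ‖({x} : Set X).indicator (fun _ => (1 : ℝ)) q.1‖ ≤ 1 := by
          by_cases hq : q.1 = x <;> simp [hq]
        have := f.norm_coe_le_norm q.2
        have := norm_nonneg (f q.2)
        nlinarith)

theorem tf_int {i : Fin n} {μ : ProbabilityMeasure (X × A i)} (h : μ ∈ MiSet G i)
    {φ : Stat G i} (hφ : Disint G i μ φ) (x : X) (f : BoundedContinuousFunction (A i) ℝ) :
    ∫ q, tf x f q ∂(μ : Measure (X × A i)) =
      ((μ : Measure (X × A i)) ({x} ×ˢ Set.univ)).toReal * ∫ b, f b ∂(φ.1 x : Measure (A i)) := by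
  conv_lhs => rw [disint_mix G h hφ]
  rw [integral_mixM (slice_pv _) _ (tf x f).continuous.measurable (tf x f).norm_coe_le_norm,
    tsum_eq_single x]
  · congr 1
    congr 1; ext b
    change ({x} : Set X).indicator (fun _ => (1 : ℝ)) x * f b = f b
    simp
  · intro y hy
    have : ∀ b, tf x f (y, b) = 0 := fun b => by
      change ({x} : Set X).indicator (fun _ => (1 : ℝ)) y * f b = 0
      simp [hy]
    simp [this]

theorem disint_tendsto (hD : AssumptionD G) {T : Type} {F : Filter T} {i : Fin n}
    {μ' : T → ProbabilityMeasure (X × A i)} {μ : ProbabilityMeasure (X × A i)}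
    {φ' : T → Stat G i} {φ : Stat G i} (hlim : Tendsto μ' F (𝓝 μ))
    (hμ : μ ∈ MiSet G i) (hφ : Disint G i μ φ)
    (hμ' : ∀ᶠ t in F, μ' t ∈ MiSet G i ∧ Disint G i (μ' t) (φ' t)) (x : X) :
    Tendsto (fun t => (φ' t).1 x) F (𝓝 (φ.1 x)) := by
  rw [ProbabilityMeasure.tendsto_iff_forall_integral_tendsto] at hlim ⊢
  intro f
  have h1 := hlim (tf x f)
  have h2 := hlim (tf x (BoundedContinuousFunction.const _ 1))
  have hpos : ∀ μ : ProbabilityMeasure (X × A i), μ ∈ MiSet G i →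
      0 < ((μ : Measure (X × A i)) ({x} ×ˢ Set.univ)).toReal := fun μ hμ =>
    ENNReal.toReal_pos (mi_pos G hD hμ x).ne' (measure_ne_top _ _)
  have e1 : ∀ (μ : ProbabilityMeasure (X × A i)) (φ : Stat G i), μ ∈ MiSet G i → Disint G i μ φ →
      (∫ q, tf x (BoundedContinuousFunction.const _ 1) q ∂(μ : Measure (X × A i))) =
      ((μ : Measure (X × A i)) ({x} ×ˢ Set.univ)).toReal := fun μ φ a b => by
    rw [tf_int G a b]; simp
  have e2 : ∀ (μ : ProbabilityMeasure (X × A i)) (φ : Stat G i), μ ∈ MiSet G i → Disint G i μ φ →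
      (∫ q, tf x f q ∂(μ : Measure (X × A i))) /
        (∫ q, tf x (BoundedContinuousFunction.const _ 1) q ∂(μ : Measure (X × A i))) =
      ∫ b, f b ∂(φ.1 x : Measure (A i)) := fun μ φ a b => by
    rw [e1 μ φ a b, tf_int G a b, mul_div_cancel_left₀ _ (hpos μ a).ne']
  have h3 := h1.div h2 (by rw [e1 μ φ hμ hφ]; exact (hpos μ hμ).ne')
  rw [e2 μ φ hμ hφ] at h3
  refine h3.congr' ?_
  filter_upwards [hμ'] with t ht
  exact e2 _ _ ht.1 ht.2

theorem usc (hA : AssumptionA G) (hC : AssumptionC G) (hD : AssumptionD G)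
    (hb : BoundedCosts G) (m : ∀ i, ProbabilityMeasure (X × A i)) (hm : ∀ i, m i ∈ MiSet G i)
    (φ : StatProfile G) (hφ : ∀ j, Disint G j (m j) (φ j))
    (V : Set (∀ i, ProbabilityMeasure (X × A i))) (hV : IsOpen V)
    (hS : Set.univ.pi (fun i => COPSol G φ i) ⊆ V) :
    ∃ U ∈ 𝓝 m, ∀ m' ∈ U, (∀ i, m' i ∈ MiSet G i) →
      ∀ φ' : StatProfile G, (∀ j, Disint G j (m' j) (φ' j)) →
        Set.univ.pi (fun i => COPSol G φ' i) ⊆ V := by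
  by_contra! hcon
  let T := (∀ i, ProbabilityMeasure (X × A i)) × StatProfile G ×
    (∀ i, ProbabilityMeasure (X × A i))
  let Bad : Set T := {t | (∀ i, t.1 i ∈ MiSet G i) ∧ (∀ j, Disint G j (t.1 j) (t.2.1 j)) ∧
    (∀ i, t.2.2 i ∈ COPSol G t.2.1 i) ∧ t.2.2 ∉ V}
  let F : Filter T := comap (fun t : T => t.1) (𝓝 m) ⊓ 𝓟 Bad
  have hF : F.NeBot := by
    rw [inf_principal_neBot_iff]
    rintro W ⟨U, hU, hUW⟩
    obtain ⟨m', hm'U, hm', φ', hφ', hns⟩ := hcon U hU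
    obtain ⟨μ, hμ, hμV⟩ := Set.not_subset.1 hns
    exact ⟨(m', φ', μ), hUW hm'U, hm', hφ', fun i => hμ i (Set.mem_univ i), hμV⟩
  let 𝒰 : Ultrafilter T := Ultrafilter.of F
  have hle : (𝒰 : Filter T) ≤ F := Ultrafilter.of_le F
  have hm' : Tendsto (fun t : T => t.1) 𝒰 (𝓝 m) :=
    tendsto_comap.mono_left (hle.trans inf_le_left)
  have hbad : ∀ᶠ t in 𝒰, t ∈ Bad := le_principal_iff.1 (hle.trans inf_le_right)
  have hφ' : ∀ j x, Tendsto (fun t : T => (t.2.1 j).1 x) 𝒰 (𝓝 ((φ j).1 x)) := fun j x =>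
    disint_tendsto G hD ((tendsto_pi_nhds.1 hm') j) (hm j) (hφ j)
      (hbad.mono fun t ht => ⟨ht.1 j, ht.2.1 j⟩) x
  choose μ hμ hlim using fun i => key2 G hA hC hb hD 𝒰 hφ' (i := i) (μ' := fun t => t.2.2 i)
    (hbad.mono fun t ht => ht.2.2.1 i)
  have hl : Tendsto (fun t : T => t.2.2) 𝒰 (𝓝 μ) := tendsto_pi_nhds.2 hlim
  have hmem : μ ∈ V := hS fun i _ => hμ i
  obtain ⟨t, ht1, ht2⟩ := ((hl.eventually (hV.mem_nhds hmem)).and hbad).exists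
  exact ht2.2.2.2 ht1

end Fin5
end CSGame

namespace CSGame

variable {n l : ℕ}
variable {X : Type} [Countable X] [MeasurableSpace X] [DiscreteMeasurableSpace X]
  [TopologicalSpace X] [DiscreteTopology X] [BorelSpace X] [SecondCountableTopology X]
variable {A : Fin n → Type} [∀ i, MeasurableSpace (A i)] [∀ i, TopologicalSpace (A i)]
  [∀ i, PolishSpace (A i)] [∀ i, BorelSpace (A i)]
variable (G : GameData n l X A)

/-- Lemma 6 and Remarks 7, 8. -/
theorem stmt12 (hA : AssumptionA G) (hC : AssumptionC G) (hD : AssumptionD G)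
    (hb : BoundedCosts G) :
    (∀ m : ∀ i, ProbabilityMeasure (X × A i), (∀ i, m i ∈ MiSet G i) →
      (∃ φ : StatProfile G, ∀ j, Disint G j (m j) (φ j)) ∧
      ∀ φ : StatProfile G, (∀ j, Disint G j (m j) (φ j)) →
        ∀ i, (COPSol G φ i).Nonempty ∧ COPSol G φ i ⊆ MiSet G i ∧
          IsCompact (COPSol G φ i) ∧
          (∀ μ₁ ∈ COPSol G φ i, ∀ μ₂ ∈ COPSol G φ i, ∀ θ : ℝ, 0 ≤ θ → θ ≤ 1 →
            ∃ μ ∈ COPSol G φ i, (μ : Measure (X × A i)) =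
              ENNReal.ofReal θ • (μ₁ : Measure (X × A i)) +
                ENNReal.ofReal (1 - θ) • (μ₂ : Measure (X × A i)))) ∧
    ∀ m : ∀ i, ProbabilityMeasure (X × A i), (∀ i, m i ∈ MiSet G i) →
      ∀ φ : StatProfile G, (∀ j, Disint G j (m j) (φ j)) →
        ∀ V : Set (∀ i, ProbabilityMeasure (X × A i)), IsOpen V →
          Set.univ.pi (fun i => COPSol G φ i) ⊆ V →
            ∃ U ∈ 𝓝 m, ∀ m' ∈ U, (∀ i, m' i ∈ MiSet G i) →
              ∀ φ' : StatProfile G, (∀ j, Disint G j (m' j) (φ' j)) →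
                Set.univ.pi (fun i => COPSol G φ' i) ⊆ V := by
  refine ⟨fun m hm => ⟨?_, fun φ _ i => ⟨sol_nonempty G hA hC hb hD φ i, sol_sub G hD φ i,
    sol_compact G hA hC hb hD φ i, sol_convex G hb φ i⟩⟩, fun m hm φ hφ V hV hS =>
    usc G hA hC hD hb m hm φ hφ V hV hS⟩
  choose φ hφ using fun j => exists_disint G hD (hm j)
  exact ⟨φ, hφ⟩


end CSGame
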